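/- arXiv:2409.14787 — 3 statements merged into one kernel-verified Lean document; each statement's English description precedes it below -/
import Mathlib

section
/- Let G be an extremal brick (a brick whose number of perfect matchings equals |E(G)| − |V(G)| + 1), and let u be a vertex of degree 3 in G such that the graph G − u − N(u), obtained by deleting u and all three of its neighbors, has exactly one perfect matching. Then the triangle-insertion G⟨u⟩ is an extremal brick. -/
open SimpleGraph

/-- The number of perfect matchings of a graph. -/
noncomputable def numPM {V : Type*} (G : SimpleGraph V) : ℕ :=
  Set.ncard {M : G.Subgraph | M.IsPerfectMatching}

/-- A graph is 3-connected if it has at least 4 vertices and deleting any set of at most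
two vertices leaves a connected graph. -/
def ThreeConnected {V : Type*} [Fintype V] (G : SimpleGraph V) : Prop :=
  4 ≤ Fintype.card V ∧
    ∀ s : Set V, s.ncard ≤ 2 → (G.induce (sᶜ : Set V)).Connected

/-- A brick: a 3-connected graph such that deleting any two distinct vertices leaves
a graph with a perfect matching (Edmonds–Lovász–Pulleyblank characterization). -/
def IsBrick {V : Type*} [Fintype V] (G : SimpleGraph V) : Prop :=
  ThreeConnected G ∧
    ∀ x y : V, x ≠ y →
      ∃ M : (G.induce {v : V | v ≠ x ∧ v ≠ y}).Subgraph, M.IsPerfectMatching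

/-- A brick is extremal when its number of perfect matchings equals |E| - |V| + 1. -/
def IsExtremal {V : Type*} [Fintype V] (G : SimpleGraph V) : Prop :=
  numPM G + Fintype.card V = G.edgeSet.ncard + 1

/-- Triangle-insertion at a vertex `u` with neighbors `a`, `b`, `c`: delete `u`,
add three pairwise adjacent new vertices `x = inr 0`, `y = inr 1`, `z = inr 2`,
together with the edges `x a`, `y b`, `z c`. -/
def triangleInsert {V : Type*} (G : SimpleGraph V) (u a b c : V) :
    SimpleGraph ({v : V // v ≠ u} ⊕ Fin 3) :=
  SimpleGraph.fromRel (fun p q =>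
    (∃ v w : {v : V // v ≠ u}, p = Sum.inl v ∧ q = Sum.inl w ∧ G.Adj v w) ∨
    (∃ v : {v : V // v ≠ u}, p = Sum.inl v ∧
      ((q = Sum.inr 0 ∧ (v : V) = a) ∨ (q = Sum.inr 1 ∧ (v : V) = b) ∨
       (q = Sum.inr 2 ∧ (v : V) = c))) ∨
    (∃ i j : Fin 3, p = Sum.inr i ∧ q = Sum.inr j))

/-- `f` encodes a perfect matching of `G[S]`. -/
def Mt {V : Type*} (G : SimpleGraph V) (S : Set V) (f : V → V) : Prop :=
  (∀ v ∈ S, f v ∈ S ∧ G.Adj v (f v) ∧ f (f v) = v) ∧ ∀ v, v ∉ S → f v = v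

/-- The subgraph encoded by a function. -/
def mtSub {V W : Type*} {G : SimpleGraph V} {H : SimpleGraph W} (e : H ↪g G) (f : V → V) :
    H.Subgraph where
  verts := Set.univ
  Adj x y := f (e x) = e y ∧ f (e y) = e x ∧ H.Adj x y
  adj_sub h := h.2.2
  edge_vert _ := Set.mem_univ _
  symm := ⟨fun _ _ h => ⟨h.2.1, h.1, h.2.2.symm⟩⟩

lemma mtSub_pm {V W : Type*} {G : SimpleGraph V} {H : SimpleGraph W} (e : H ↪g G) (f : V → V)
    (hf : Mt G (Set.range e) f) : (mtSub e f).IsPerfectMatching := by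
  rw [Subgraph.isPerfectMatching_iff]
  intro x
  obtain ⟨⟨y, hy⟩, h2, h3⟩ := hf.1 (e x) ⟨x, rfl⟩
  refine ⟨y, ⟨hy.symm, ?_, ?_⟩, ?_⟩
  · rw [hy, h3]
  · rw [← hy] at h2
    exact e.map_adj_iff.1 h2
  · rintro z ⟨hz, -⟩
    exact e.injective (hz.symm.trans hy.symm)

lemma mtSub_surj {V W : Type*} {G : SimpleGraph V} {H : SimpleGraph W} (e : H ↪g G)
    (M : H.Subgraph) (hM : M.IsPerfectMatching) :
    ∃ f, Mt G (Set.range e) f ∧ mtSub e f = M := by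
  classical
  have hM' := Subgraph.isPerfectMatching_iff.1 hM
  choose p hp hp' using hM'
  have hpp : ∀ x, p (p x) = x := fun x => (hp' _ _ (hp x).symm).symm
  let f : V → V := fun v => if h : ∃ x, e x = v then e (p h.choose) else v
  have hf : ∀ x, f (e x) = e (p x) := by
    intro x
    have h : ∃ y, e y = e x := ⟨x, rfl⟩
    simp only [f, dif_pos h]
    rw [e.injective h.choose_spec]
  refine ⟨f, ⟨?_, ?_⟩, ?_⟩
  · rintro _ ⟨x, rfl⟩
    refine ⟨⟨p x, (hf x).symm⟩, ?_, ?_⟩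
    · rw [hf]; exact e.map_adj_iff.2 (M.adj_sub (hp x))
    · rw [hf, hf, hpp]
  · intro v hv
    simp only [f]
    rw [dif_neg]
    exact hv
  · ext x y
    · simp only [mtSub, Set.mem_univ, true_iff]
      exact hM.2 x
    · simp only [mtSub, hf]
      constructor
      · rintro ⟨h, -⟩
        rw [← e.injective h]; exact hp x
      · intro h
        have : y = p x := hp' _ _ h
        subst this
        exact ⟨rfl, by rw [hpp], M.adj_sub h⟩

lemma numPM_eq {V W : Type*} {G : SimpleGraph V} {H : SimpleGraph W} (e : H ↪g G) :
    numPM H = Nat.card {f : V → V // Mt G (Set.range e) f} := by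
  unfold numPM
  rw [← Nat.card_coe_set_eq]
  symm
  refine Nat.card_congr (Equiv.ofBijective
    (fun f => ⟨mtSub e f.1, mtSub_pm e f.1 f.2⟩) ⟨?_, ?_⟩)
  · rintro ⟨f, hf⟩ ⟨g, hg⟩ h
    have h1 : mtSub e f = mtSub e g := congrArg Subtype.val h
    apply Subtype.ext
    funext v
    by_cases hv : v ∈ Set.range e
    · obtain ⟨x, rfl⟩ := hv
      obtain ⟨y, hy, -⟩ := (Subgraph.isPerfectMatching_iff.1 (mtSub_pm e f hf)) x
      have hy2 := hy
      rw [h1] at hy2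
      exact hy.1.trans hy2.1.symm
    · exact (hf.2 v hv).trans (hg.2 v hv).symm
  · rintro ⟨M, hM⟩
    obtain ⟨f, hf, h⟩ := mtSub_surj e M hM
    exact ⟨⟨f, hf⟩, Subtype.ext h⟩

lemma numPM_univ {V : Type*} (G : SimpleGraph V) :
    numPM G = Nat.card {f : V → V // Mt G Set.univ f} := by
  rw [numPM_eq (SimpleGraph.Embedding.refl (G := G))]
  have : Set.range (SimpleGraph.Embedding.refl (G := G)) = Set.univ := by
    ext x; simp
  rw [this]

lemma range_ind {V : Type*} (G : SimpleGraph V) (S : Set V) :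
    Set.range (SimpleGraph.Embedding.induce (G := G) S) = S := by
  ext x; simp

lemma numPM_ind {V : Type*} (G : SimpleGraph V) (S : Set V) :
    numPM (G.induce S) = Nat.card {f : V → V // Mt G S f} := by
  rw [numPM_eq (SimpleGraph.Embedding.induce (G := G) S), range_ind]

lemma exPM_ind {V : Type*} (G : SimpleGraph V) (S : Set V) :
    (∃ M : (G.induce S).Subgraph, M.IsPerfectMatching) ↔ ∃ f, Mt G S f := by
  constructor
  · rintro ⟨M, hM⟩
    obtain ⟨f, hf, -⟩ := mtSub_surj (SimpleGraph.Embedding.induce (G := G) S) M hM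
    rw [range_ind] at hf
    exact ⟨f, hf⟩
  · rintro ⟨f, hf⟩
    rw [← range_ind G S] at hf
    exact ⟨_, mtSub_pm _ f hf⟩

lemma connected_of_map {V W : Type*} {H : SimpleGraph V} {K : SimpleGraph W}
    (hH : H.Connected) (φ : V → W) (h1 : ∀ v w, H.Adj v w → K.Reachable (φ v) (φ w))
    (h2 : ∀ x, ∃ v, K.Reachable x (φ v)) : K.Connected := by
  obtain ⟨v0⟩ := hH.nonempty
  have key : ∀ v w, K.Reachable (φ v) (φ w) := by
    intro v w
    obtain ⟨p⟩ := hH.preconnected v w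
    induction p with
    | nil => exact Reachable.refl _
    | cons h _ ih => exact (h1 _ _ h).trans ih
  have : Nonempty W := ⟨φ v0⟩
  refine ⟨fun x y => ?_⟩
  obtain ⟨v, hv⟩ := h2 x
  obtain ⟨w, hw⟩ := h2 y
  exact hv.trans ((key v w).trans hw.symm)

section tri
variable {V : Type*} {G : SimpleGraph V} {u : V}

/-- Triangle insertion, with neighbours as a function. -/
def nb (a b c : V) : Fin 3 → V := ![a, b, c]

lemma tri_ll (G : SimpleGraph V) (u a b c : V) (v w : {v : V // v ≠ u}) :
    (triangleInsert G u a b c).Adj (Sum.inl v) (Sum.inl w) ↔ G.Adj v w := by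
  have := G.adj_comm w v
  simp only [triangleInsert, fromRel_adj]
  constructor
  · rintro ⟨-, h⟩
    simpa [this] using h
  · intro h
    refine ⟨?_, Or.inl (Or.inl ⟨v, w, rfl, rfl, h⟩)⟩
    rintro h'
    have : v = w := Sum.inl.inj h'
    subst this
    exact h.ne rfl

lemma tri_lr (G : SimpleGraph V) (u a b c : V) (v : {v : V // v ≠ u}) (j : Fin 3) :
    (triangleInsert G u a b c).Adj (Sum.inl v) (Sum.inr j) ↔ (v : V) = nb a b c j := by
  simp only [triangleInsert, fromRel_adj]
  fin_cases j <;> simp [nb]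

lemma tri_rl (G : SimpleGraph V) (u a b c : V) (v : {v : V // v ≠ u}) (j : Fin 3) :
    (triangleInsert G u a b c).Adj (Sum.inr j) (Sum.inl v) ↔ (v : V) = nb a b c j := by
  rw [adj_comm, tri_lr]

lemma tri_rr (G : SimpleGraph V) (u a b c : V) (i j : Fin 3) :
    (triangleInsert G u a b c).Adj (Sum.inr i) (Sum.inr j) ↔ i ≠ j := by
  simp [triangleInsert, fromRel_adj]

end tri

lemma f3a : ∀ i j : Fin 3, j ≠ i → -(i+j) ≠ i := by decide
lemma f3b : ∀ i j : Fin 3, j ≠ i → j ≠ -(i+j) := by decide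
lemma f3c : ∀ i j : Fin 3, -(i + -(i+j)) = j := by decide

/-- Abstract description of a triangle insertion. -/
structure Tri {V : Type*} (G : SimpleGraph V) (u : V) (n : Fin 3 → V)
    (T : SimpleGraph ({v : V // v ≠ u} ⊕ Fin 3)) : Prop where
  inj : ∀ i j, n i = n j → i = j
  adj_u : ∀ v, G.Adj u v ↔ ∃ j, v = n j
  ne_u : ∀ j, n j ≠ u
  ll : ∀ v w, T.Adj (Sum.inl v) (Sum.inl w) ↔ G.Adj v w
  lr : ∀ v j, T.Adj (Sum.inl v) (Sum.inr j) ↔ (v : V) = n j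
  rl : ∀ v j, T.Adj (Sum.inr j) (Sum.inl v) ↔ (v : V) = n j
  rr : ∀ i j, T.Adj (Sum.inr i) (Sum.inr j) ↔ i ≠ j

open Classical in
/-- Lift a vertex of `V`, sending `u` to `inr d`. -/
noncomputable def Lft {V : Type*} (u : V) (d : Fin 3) (x : V) : {v : V // v ≠ u} ⊕ Fin 3 :=
  if h : x ≠ u then Sum.inl ⟨x, h⟩ else Sum.inr d

lemma Lft_ne {V : Type*} {u : V} (d : Fin 3) {x : V} (h : x ≠ u) :
    Lft u d x = Sum.inl ⟨x, h⟩ := dif_pos h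

lemma Lft_u {V : Type*} (u : V) (d : Fin 3) : Lft u d u = Sum.inr d :=
  dif_neg (fun h => h rfl)

lemma Lft_inj {V : Type*} (u : V) (d : Fin 3) : Function.Injective (Lft u d) := by
  intro x y h
  by_cases hx : x = u <;> by_cases hy : y = u
  · rw [hx, hy]
  · rw [hx, Lft_u, Lft_ne d hy] at h; cases h
  · rw [hy, Lft_u, Lft_ne d hx] at h; cases h
  · rw [Lft_ne d hx, Lft_ne d hy] at h
    exact congrArg Subtype.val (Sum.inl.inj h)

/-- Lift a matching of `G` using the edge `u (n i)`. -/
noncomputable def liftA {V : Type*} (u : V) (n : Fin 3 → V) (i : Fin 3) (g : V → V) :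
    {v : V // v ≠ u} ⊕ Fin 3 → {v : V // v ≠ u} ⊕ Fin 3
  | Sum.inl v => Lft u i (g v)
  | Sum.inr j => if j = i then Lft u i (n i) else Sum.inr (-(i + j))

open Classical in
/-- Lift a matching of `G` avoiding `u` and the `n j` with `j ∈ J`. -/
noncomputable def liftC {V : Type*} (u : V) (n : Fin 3 → V) (J : Set (Fin 3))
    (σ : Fin 3 → Fin 3) (g : V → V) :
    {v : V // v ≠ u} ⊕ Fin 3 → {v : V // v ≠ u} ⊕ Fin 3
  | Sum.inl v => if h : ∃ j ∈ J, (v : V) = n j then Sum.inr h.choose else Lft u 0 (g v)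
  | Sum.inr j => if j ∈ J then Lft u 0 (n j) else Sum.inr (σ j)

section tri2
variable {V : Type*} {G : SimpleGraph V} {u : V} {n : Fin 3 → V}
  {T : SimpleGraph ({v : V // v ≠ u} ⊕ Fin 3)}

lemma liftA_mt (hT : Tri G u n T) {S : Set V} {S' : Set ({v : V // v ≠ u} ⊕ Fin 3)}
    (hl : ∀ v, Sum.inl v ∈ S' ↔ (v : V) ∈ S) (hr : ∀ j, Sum.inr j ∈ S')
    (hu : u ∈ S) {g : V → V} (hg : Mt G S g) {i : Fin 3} (hi : g u = n i) :
    Mt T S' (liftA u n i g) := by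
  have hni : liftA u n i g (Sum.inl ⟨n i, hT.ne_u i⟩) = Sum.inr i := by
    simp only [liftA]
    rw [← hi, (hg.1 u hu).2.2, Lft_u]
  have hri : liftA u n i g (Sum.inr i) = Sum.inl ⟨n i, hT.ne_u i⟩ := by
    simp only [liftA, if_true]
    rw [Lft_ne]
  constructor
  · rintro (v | j) hv
    · have hvS := (hl v).1 hv
      obtain ⟨h1, h2, h3⟩ := hg.1 v hvS
      by_cases hgv : g v = u
      · have hvn : (v : V) = n i := by rw [← h3, hgv, hi]
        have hv' : v = ⟨n i, hT.ne_u i⟩ := Subtype.ext hvn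
        rw [hv', hni, hri]
        exact ⟨hr i, (hT.lr _ _).2 rfl, rfl⟩
      · have e : liftA u n i g (Sum.inl v) = Sum.inl ⟨g v, hgv⟩ := by
          simp only [liftA]; rw [Lft_ne]
        rw [e]
        refine ⟨(hl _).2 h1, (hT.ll _ _).2 h2, ?_⟩
        simp only [liftA]
        rw [h3, Lft_ne]
    · by_cases hj : j = i
      · subst hj
        rw [hri, hni]
        refine ⟨(hl _).2 ?_, (hT.rl _ _).2 rfl, rfl⟩
        change n j ∈ S
        rw [← hi]; exact (hg.1 u hu).1
      · have e : liftA u n i g (Sum.inr j) = Sum.inr (-(i + j)) := by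
          simp only [liftA, if_neg hj]
        have h1 : -(i+j) ≠ i := f3a i j hj
        have h2 : j ≠ -(i+j) := f3b i j hj
        have h3 : -(i + -(i+j)) = j := f3c i j
        rw [e]
        refine ⟨hr _, (hT.rr _ _).2 h2, ?_⟩
        simp only [liftA, if_neg h1, h3]
  · rintro (v | j) hv
    · simp only [liftA]
      rw [hg.2 v (fun h => hv ((hl v).2 h)), Lft_ne]
    · exact absurd (hr j) hv

lemma liftC_mt (hT : Tri G u n T) {S : Set V} {S' : Set ({v : V // v ≠ u} ⊕ Fin 3)}
    {J : Set (Fin 3)} {σ : Fin 3 → Fin 3}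
    (hl : ∀ v, Sum.inl v ∈ S' ↔ ((v : V) ∈ S ∨ ∃ j ∈ J, (v : V) = n j))
    (hJ : ∀ j ∈ J, n j ∉ S ∧ Sum.inr j ∈ S')
    (hσ : ∀ j, j ∉ J → Sum.inr j ∈ S' → σ j ∉ J ∧ Sum.inr (σ j) ∈ S' ∧ j ≠ σ j ∧ σ (σ j) = j)
    (hσ' : ∀ j, j ∉ J → Sum.inr j ∉ S' → σ j = j)
    (hu : u ∉ S) {g : V → V} (hg : Mt G S g) :
    Mt T S' (liftC u n J σ g) := by
  have hni : ∀ i ∈ J, liftC u n J σ g (Sum.inl ⟨n i, hT.ne_u i⟩) = Sum.inr i := by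
    intro i hi
    have h : ∃ j ∈ J, n i = n j := ⟨i, hi, rfl⟩
    simp only [liftC]
    rw [dif_pos h]
    congr 1
    exact (hT.inj _ _ h.choose_spec.2).symm
  have hri : ∀ i ∈ J, liftC u n J σ g (Sum.inr i) = Sum.inl ⟨n i, hT.ne_u i⟩ := by
    intro i hi
    simp only [liftC, if_pos hi]
    rw [Lft_ne]
  have hS : ∀ v (hv : v ≠ u) (h' : g v ≠ u), (¬ ∃ j ∈ J, v = n j) →
      liftC u n J σ g (Sum.inl ⟨v, hv⟩) = Sum.inl ⟨g v, h'⟩ := by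
    intro v hv h' h
    simp only [liftC]
    rw [dif_neg h, Lft_ne]
  constructor
  · rintro (⟨v, hvu⟩ | j) hv
    · by_cases hvJ : ∃ j ∈ J, v = n j
      · obtain ⟨j, hj, rfl⟩ := hvJ
        rw [hni j hj, hri j hj]
        exact ⟨(hJ j hj).2, (hT.lr _ _).2 rfl, rfl⟩
      · have hvS : v ∈ S := ((hl _).1 hv).resolve_right hvJ
        obtain ⟨h1, h2, h3⟩ := hg.1 v hvS
        have h4 : g v ≠ u := fun h => hu (h ▸ h1)
        have h5 : ¬ ∃ j ∈ J, g v = n j := by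
          rintro ⟨j, hj, h⟩
          exact (hJ j hj).1 (h ▸ h1)
        rw [hS v hvu h4 hvJ, hS (g v) h4 (by rw [h3]; exact hvu) h5]
        refine ⟨(hl _).2 (Or.inl h1), (hT.ll _ _).2 h2, ?_⟩
        simp only [h3]
    · by_cases hj : j ∈ J
      · rw [hri j hj, hni j hj]
        exact ⟨(hl _).2 (Or.inr ⟨j, hj, rfl⟩), (hT.rl _ _).2 rfl, rfl⟩
      · obtain ⟨h1, h2, h3, h4⟩ := hσ j hj hv
        simp only [liftC, if_neg hj, if_neg h1, h4]
        exact ⟨h2, (hT.rr _ _).2 h3, trivial⟩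
  · rintro (⟨v, hvu⟩ | j) hv
    · have h6 := hg.2 v (fun h => hv ((hl _).2 (Or.inl h)))
      have h7 : ¬ ∃ j ∈ J, v = n j := by
        exact fun h => hv ((hl _).2 (Or.inr h))
      rw [hS v hvu (by rw [h6]; exact hvu) h7]
      simp only [h6]
    · have hj : j ∉ J := fun h => hv (hJ j h).2
      simp only [liftC, if_neg hj]
      rw [hσ' j hj hv]

lemma tri_bicrit (hT : Tri G u n T)
    (hG : ∀ x y : V, x ≠ y → ∃ f, Mt G {v | v ≠ x ∧ v ≠ y} f)
    (p q : {v : V // v ≠ u} ⊕ Fin 3) (hpq : p ≠ q) :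
    ∃ f, Mt T {v | v ≠ p ∧ v ≠ q} f := by
  have mixed : ∀ (p : {v : V // v ≠ u}) (q : Fin 3),
      ∃ f, Mt T {v | v ≠ Sum.inl p ∧ v ≠ Sum.inr q} f := by
    intro p q
    obtain ⟨g, hg⟩ := hG p u p.2
    refine ⟨_, liftC_mt hT (J := ∅) (σ := fun j => if j = q then q else -(j+q))
      ?_ ?_ ?_ ?_ ?_ hg⟩
    · rintro ⟨v, hv⟩
      simp [hv, Subtype.ext_iff]
    · simp
    · intro j _ hj
      have hj' : j ≠ q := by
        rintro rfl; simp at hj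
      have h1 : -(j+q) ≠ q := by rw [add_comm]; exact f3a q j hj'
      have h2 : j ≠ -(j+q) := by rw [add_comm]; exact f3b q j hj'
      have h3 : -(-(j+q)+q) = j := by rw [add_comm, add_comm j]; exact f3c q j
      simp only [if_neg hj', if_neg h1]
      exact ⟨by simp, ⟨by simp, by simpa using h1⟩, h2, h3⟩
    · intro j _ hj
      have : j = q := by
        by_contra h; apply hj; simp [h]
      simp [this]
    · simp
  have swap : ∀ (p q : {v : V // v ≠ u} ⊕ Fin 3), {v | v ≠ p ∧ v ≠ q} = {v | v ≠ q ∧ v ≠ p} := by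
    intro p q; ext; simp [and_comm]
  rcases p with p | p <;> rcases q with q | q
  · obtain ⟨g, hg⟩ := hG p q (fun h => hpq (by rw [Subtype.ext h]))
    have huS : u ∈ {v | v ≠ p.1 ∧ v ≠ q.1} := ⟨p.2.symm, q.2.symm⟩
    obtain ⟨i, hi⟩ := (hT.adj_u _).1 (hg.1 u huS).2.1
    refine ⟨_, liftA_mt hT ?_ ?_ huS hg hi⟩
    · rintro ⟨v, hv⟩
      simp [Subtype.ext_iff]
    · simp
  · exact mixed p q
  · rw [swap]; exact mixed q p
  · have hpq' : p ≠ q := fun h => hpq (by rw [h])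
    obtain ⟨g, hg⟩ := hG (n (-(p+q))) u (hT.ne_u _)
    refine ⟨_, liftC_mt hT (J := {-(p+q)}) (σ := id)
      ?_ ?_ ?_ ?_ ?_ hg⟩
    · rintro ⟨v, hv⟩
      simp [hv, em']
    · rintro j rfl
      have h1 : -(p+q) ≠ p := f3a p q hpq'.symm
      have h2 : -(p+q) ≠ q := (f3b p q hpq'.symm).symm
      exact ⟨by simp, by simpa using h1, by simpa using h2⟩
    · intro j hj hj'
      exfalso
      have h1 : j ≠ p := by rintro rfl; simp at hj'
      have h2 : j ≠ q := by rintro rfl; simp at hj'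
      have h3 : j ≠ -(p+q) := hj
      clear hj hj' hpq hg
      revert j p q; decide
    · simp
    · simp

lemma tri_conn [Finite V] (hT : Tri G u n T)
    (hG : ∀ s : Set V, s.ncard ≤ 2 → (G.induce (sᶜ : Set V)).Connected)
    (s' : Set ({v : V // v ≠ u} ⊕ Fin 3)) (hs' : s'.ncard ≤ 2) :
    (T.induce (s'ᶜ : Set _)).Connected := by
  obtain ⟨t, ht⟩ : ∃ t : Fin 3, (∀ j, Sum.inr j ∉ s') ∨ Sum.inr t ∈ s' := by
    by_cases h : ∃ t : Fin 3, Sum.inr t ∈ s'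
    · obtain ⟨t, h⟩ := h; exact ⟨t, Or.inr h⟩
    · push Not at h; exact ⟨0, Or.inl h⟩
  have hs : (Lft u t ⁻¹' s').ncard ≤ 2 := by
    refine le_trans ?_ hs'
    exact Set.ncard_le_ncard_of_injOn (Lft u t) (fun _ h => h) (Lft_inj u t).injOn
      (Set.toFinite _)
  have hc := hG _ hs
  have adjR : ∀ x y (hx : x ∉ s') (hy : y ∉ s'), T.Adj x y →
      (T.induce (s'ᶜ : Set _)).Reachable ⟨x, hx⟩ ⟨y, hy⟩ := by
    intro x y hx hy h
    exact Adj.reachable (by simpa using h)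
  refine connected_of_map hc (fun v => ⟨Lft u t v.1, v.2⟩) ?_ ?_
  · have key : ∀ w (hu : Lft u t u ∉ s') (hw : Lft u t w ∉ s'), G.Adj u w →
        (T.induce (s'ᶜ : Set _)).Reachable ⟨Lft u t u, hu⟩ ⟨Lft u t w, hw⟩ := by
      intro w hu hw h
      have hu' := hu
      rw [Lft_u] at hu'
      have ht' := ht.resolve_right hu'
      obtain ⟨j, rfl⟩ := (hT.adj_u w).1 h
      have h1 : (T.induce (s'ᶜ : Set _)).Reachable ⟨Sum.inr j, ht' j⟩ ⟨Lft u t (n j), hw⟩ := by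
        apply adjR
        rw [Lft_ne _ (hT.ne_u j)]
        exact (hT.rl _ _).2 rfl
      refine Reachable.trans ?_ h1
      simp only [Lft_u]
      by_cases hjt : t = j
      · subst hjt; exact Reachable.refl _
      · exact adjR _ _ _ _ ((hT.rr _ _).2 hjt)
    rintro ⟨v, hv⟩ ⟨w, hw⟩ hvw
    have hvw : G.Adj v w := by simpa using hvw
    by_cases hvu : v = u
    · subst hvu; exact key w hv hw hvw
    · by_cases hwu : w = u
      · subst hwu; exact (key v hw hv hvw.symm).symm
      · apply adjR
        rw [Lft_ne _ hvu, Lft_ne _ hwu]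
        exact (hT.ll _ _).2 hvw
  · rintro ⟨v | j, hx⟩
    · refine ⟨⟨v.1, ?_⟩, ?_⟩
      · change Lft u t v.1 ∉ s'
        rw [Lft_ne _ v.2]; exact hx
      · simp only [Lft_ne _ v.2]
        exact Reachable.refl _
    · rcases ht with ht | ht
      · refine ⟨⟨u, ?_⟩, ?_⟩
        · change Lft u t u ∉ s'
          rw [Lft_u]; exact ht t
        · simp only [Lft_u]
          by_cases hjt : j = t
          · subst hjt; exact Reachable.refl _
          · exact adjR _ _ _ _ ((hT.rr _ _).2 hjt)
      · have hjt : j ≠ t := by rintro rfl; exact hx ht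
        by_cases hj : Lft u t (n j) ∈ s'
        · have hno : ∀ x, x ∈ s' → x = Sum.inr t ∨ x = Lft u t (n j) := by
            intro x hxs
            by_contra hcon
            push Not at hcon
            have h2 : ({Sum.inr t, Lft u t (n j), x} : Set _) ⊆ s' := by
              rintro y (rfl | rfl | rfl) <;> assumption
            have h3 := Set.ncard_le_ncard h2 (Set.toFinite _)
            rw [Set.ncard_eq_three.2 ⟨_, _, _, ?_, ?_, ?_, rfl⟩] at h3
            · omega
            · rw [Lft_ne _ (hT.ne_u j)]; simp
            · exact hcon.1.symm
            · exact hcon.2.symm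
          have hk1 := f3a t j hjt
          have hk2 := f3b t j hjt
          have hk3 : (Sum.inr (-(t+j)) : {v : V // v ≠ u} ⊕ Fin 3) ∉ s' := by
            intro h
            rcases hno _ h with h | h
            · exact hk1 (Sum.inr.inj h)
            · rw [Lft_ne _ (hT.ne_u j)] at h; cases h
          have hk4 : Lft u t (n (-(t+j))) ∉ s' := by
            intro h
            rcases hno _ h with h | h
            · rw [Lft_ne _ (hT.ne_u _)] at h; cases h
            · exact hk2 (hT.inj _ _ (Lft_inj u t h)).symm
          refine ⟨⟨n (-(t+j)), hk4⟩, ?_⟩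
          refine (adjR _ _ hx hk3 ((hT.rr _ _).2 hk2)).trans (adjR _ _ _ _ ?_)
          rw [Lft_ne _ (hT.ne_u _)]
          exact (hT.rl _ _).2 rfl
        · refine ⟨⟨n j, hj⟩, ?_⟩
          apply adjR
          rw [Lft_ne _ (hT.ne_u _)]
          exact (hT.rl _ _).2 rfl

lemma two_edges {W : Type*} [Fintype W] (H : SimpleGraph W) :
    ∑ v, (H.neighborSet v).ncard = 2 * H.edgeSet.ncard := by
  classical
  rw [← coe_edgeFinset, Set.ncard_coe_finset, ← sum_degrees_eq_twice_card_edges]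
  refine Finset.sum_congr rfl fun v _ => ?_
  rw [Set.ncard_eq_toFinset_card']
  rfl

lemma tri_edges [Fintype V] [DecidableEq V] (hT : Tri G u n T) :
    T.edgeSet.ncard = G.edgeSet.ncard + 3 := by
  have h1 := two_edges T
  have h2 := two_edges G
  rw [Fintype.sum_sum_type] at h1
  have h3 : ∀ v : {v : V // v ≠ u}, (T.neighborSet (Sum.inl v)).ncard =
      (G.neighborSet v.1).ncard := by
    intro v
    obtain ⟨d, hd⟩ : ∃ d : Fin 3, ∀ j, v.1 = n j → j = d := by
      by_cases h : ∃ d, v.1 = n d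
      · obtain ⟨d, hd⟩ := h
        exact ⟨d, fun j hj => hT.inj _ _ (hj.symm.trans hd)⟩
      · exact ⟨0, fun j hj => absurd ⟨j, hj⟩ h⟩
    rw [← Set.ncard_image_of_injective _ (Lft_inj u d)]
    congr 1
    ext x
    simp only [Set.mem_image, mem_neighborSet]
    rcases x with w | j
    · rw [hT.ll]
      constructor
      · intro h; exact ⟨w, h, Lft_ne _ w.2⟩
      · rintro ⟨x, hx, h⟩
        by_cases hxu : x = u
        · rw [hxu, Lft_u] at h; cases h
        · rw [Lft_ne _ hxu] at h
          rw [← Sum.inl.inj h]; exact hx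
    · rw [hT.lr]
      constructor
      · intro h
        refine ⟨u, ((hT.adj_u _).2 ⟨j, h⟩).symm, ?_⟩
        rw [Lft_u, hd j h]
      · rintro ⟨x, hx, h⟩
        by_cases hxu : x = u
        · subst hxu
          rw [Lft_u] at h
          obtain ⟨k, hk⟩ := (hT.adj_u _).1 hx.symm
          rw [← Sum.inr.inj h, ← hd k hk]; exact hk
        · rw [Lft_ne _ hxu] at h; cases h
  have h4 : ∀ j : Fin 3, (T.neighborSet (Sum.inr j)).ncard = 3 := by
    intro j
    rw [Set.ncard_eq_three]
    refine ⟨Sum.inl ⟨n j, hT.ne_u j⟩, Sum.inr (j+1), Sum.inr (j+2), by simp, by simp, ?_, ?_⟩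
    · simp
    · ext x
      rcases x with w | k
      · simp [hT.rl, Subtype.ext_iff]
      · simp only [mem_neighborSet, hT.rr, Set.mem_insert_iff, Set.mem_singleton_iff, reduceCtorEq,
          false_or, Sum.inr.injEq]
        revert j k; decide
  have h5 : (G.neighborSet u).ncard = 3 := by
    rw [Set.ncard_eq_three]
    refine ⟨n 0, n 1, n 2, fun h => ?_, fun h => ?_, fun h => ?_, ?_⟩
    · exact absurd (hT.inj _ _ h) (by decide)
    · exact absurd (hT.inj _ _ h) (by decide)
    · exact absurd (hT.inj _ _ h) (by decide)
    · ext x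
      simp [hT.adj_u, Fin.exists_fin_succ]
  rw [Fintype.sum_eq_add_sum_subtype_ne _ u, h5] at h2
  simp only [h3, h4, Finset.sum_const, Finset.card_univ, Fintype.card_fin] at h1
  simp only [smul_eq_mul] at h1
  omega

/-- Project back to `V`. -/
def prj (u : V) : {v : V // v ≠ u} ⊕ Fin 3 → V
  | Sum.inl v => v
  | Sum.inr _ => u

lemma surjA (hT : Tri G u n T) {h : {v : V // v ≠ u} ⊕ Fin 3 → {v : V // v ≠ u} ⊕ Fin 3}
    (hh : Mt T Set.univ h) {j k : Fin 3} (hjk : h (Sum.inr j) = Sum.inr k) :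
    ∃ g i, Mt G Set.univ g ∧ g u = n i ∧ liftA u n i g = h := by
  classical
  have hadj := fun x => (hh.1 x (Set.mem_univ _)).2.1
  have hinv := fun x => (hh.1 x (Set.mem_univ _)).2.2
  have hkj : h (Sum.inr k) = Sum.inr j := by rw [← hjk, hinv]
  have hne : k ≠ j := by
    have := hadj (Sum.inr j)
    rw [hjk, hT.rr] at this
    exact this.symm
  obtain ⟨i, hi⟩ : ∃ i, i = -(j + k) := ⟨_, rfl⟩
  have hij : i ≠ j := hi ▸ f3a j k hne
  have hik : i ≠ k := (hi ▸ f3b j k hne : k ≠ i).symm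
  have hall : ∀ m, m = i ∨ m = j ∨ m = k := by
    clear hjk hkj
    revert i j k; decide
  have hri : h (Sum.inr i) = Sum.inl ⟨n i, hT.ne_u i⟩ := by
    rcases hx : h (Sum.inr i) with v | m
    · have := hadj (Sum.inr i)
      rw [hx, hT.rl] at this
      congr 1
      exact Subtype.ext this
    · exfalso
      have h1 : h (Sum.inr m) = Sum.inr i := by rw [← hx, hinv]
      rcases hall m with rfl | rfl | rfl
      · have := hadj (Sum.inr m)
        rw [hx, hT.rr] at this
        exact this rfl
      · rw [hjk] at h1; exact hik (Sum.inr.inj h1).symm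
      · rw [hkj] at h1; exact hij (Sum.inr.inj h1).symm
  have hli : h (Sum.inl ⟨n i, hT.ne_u i⟩) = Sum.inr i := by rw [← hri, hinv]
  have hlr : ∀ v m, h (Sum.inl v) = Sum.inr m → m = i ∧ v.1 = n i := by
    intro v m hv
    have h1 : h (Sum.inr m) = Sum.inl v := by rw [← hv, hinv]
    rcases hall m with rfl | rfl | rfl
    · rw [hri] at h1
      exact ⟨rfl, congrArg Subtype.val (Sum.inl.inj h1).symm⟩
    · rw [hjk] at h1; cases h1
    · rw [hkj] at h1; cases h1
  let g : V → V := fun v => if hv : v = u then n i else prj u (h (Sum.inl ⟨v, hv⟩))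
  have gu : g u = n i := by simp [g]
  have gv : ∀ v (hv : v ≠ u), g v = prj u (h (Sum.inl ⟨v, hv⟩)) := by
    intro v hv; simp [g, hv]
  have gni : g (n i) = u := by rw [gv _ (hT.ne_u i), hli]; rfl
  refine ⟨g, i, ⟨?_, fun v hv => absurd (Set.mem_univ _) hv⟩, gu, ?_⟩
  · intro v _
    refine ⟨Set.mem_univ _, ?_⟩
    by_cases hv : v = u
    · subst hv
      rw [gu, gni]
      exact ⟨(hT.adj_u _).2 ⟨i, rfl⟩, rfl⟩
    · have h2 := gv v hv
      rcases hx : h (Sum.inl ⟨v, hv⟩) with w | m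
      · have h3 := hadj (Sum.inl ⟨v, hv⟩)
        rw [hx, hT.ll] at h3
        rw [hx] at h2
        change g v = w.1 at h2
        rw [h2]
        refine ⟨h3, ?_⟩
        rw [gv w.1 w.2]
        change prj u (h (Sum.inl w)) = v
        rw [← hx, hinv]
        rfl
      · obtain ⟨-, h3⟩ := hlr _ _ hx
        change v = n i at h3
        subst h3
        rw [gni, gu]
        exact ⟨((hT.adj_u _).2 ⟨i, rfl⟩).symm, rfl⟩
  · funext x
    rcases x with v | m
    · simp only [liftA]
      rw [gv v.1 v.2]
      change Lft u i (prj u (h (Sum.inl v))) = _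
      rcases hx : h (Sum.inl v) with w | m
      · exact Lft_ne _ w.2
      · rw [(hlr _ _ hx).1]; exact Lft_u _ _
    · simp only [liftA]
      split_ifs with hm
      · rw [hm, hri, Lft_ne]
      · rcases hall m with h1 | h1 | h1
        · exact absurd h1 hm
        · rw [h1, hjk, hi]; clear * -; congr 1; revert j k; decide
        · rw [h1, hkj, hi]; clear * -; congr 1; revert j k; decide

lemma liftC_n (hT : Tri G u n T) (g : V → V) (j : Fin 3) (h : n j ≠ u) :
    liftC u n Set.univ id g (Sum.inl ⟨n j, h⟩) = Sum.inr j := by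
  have h : ∃ k ∈ Set.univ, n j = n k := ⟨j, Set.mem_univ _, rfl⟩
  simp only [liftC]
  rw [dif_pos h]
  congr 1
  exact (hT.inj _ _ h.choose_spec.2).symm

lemma liftC_o (g : V → V) (v : {v : V // v ≠ u}) (h : ∀ j, v.1 ≠ n j) :
    liftC u n Set.univ id g (Sum.inl v) = Lft u 0 (g v) := by
  simp only [liftC]
  rw [dif_neg]
  rintro ⟨j, -, hj⟩
  exact h j hj

lemma surjC (hT : Tri G u n T) {h : {v : V // v ≠ u} ⊕ Fin 3 → {v : V // v ≠ u} ⊕ Fin 3}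
    (hh : Mt T Set.univ h) (hjk : ∀ j k : Fin 3, h (Sum.inr j) ≠ Sum.inr k) :
    ∃ g, Mt G {v | v ≠ u ∧ ∀ j, v ≠ n j} g ∧ liftC u n Set.univ id g = h := by
  classical
  have hadj := fun x => (hh.1 x (Set.mem_univ _)).2.1
  have hinv := fun x => (hh.1 x (Set.mem_univ _)).2.2
  have hr : ∀ j, h (Sum.inr j) = Sum.inl ⟨n j, hT.ne_u j⟩ := by
    intro j
    rcases hx : h (Sum.inr j) with v | m
    · have := hadj (Sum.inr j)
      rw [hx, hT.rl] at this
      congr 1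
      exact Subtype.ext this
    · exact absurd hx (hjk _ _)
  have hl : ∀ j, h (Sum.inl ⟨n j, hT.ne_u j⟩) = Sum.inr j := fun j => by rw [← hr, hinv]
  let g : V → V := fun v => if hv : v ≠ u ∧ ∀ j, v ≠ n j then
    prj u (h (Sum.inl ⟨v, hv.1⟩)) else v
  have hin : ∀ v : {v : V // v ≠ u}, (∀ j, v.1 ≠ n j) →
      ∃ w : {v : V // v ≠ u}, h (Sum.inl v) = Sum.inl w ∧ (∀ j, w.1 ≠ n j) ∧ g v = w := by
    intro v hv
    have hgv : g v = prj u (h (Sum.inl v)) := by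
      simp only [g]; rw [dif_pos ⟨v.2, hv⟩]
    rcases hx : h (Sum.inl v) with w | m
    · refine ⟨w, rfl, ?_, by rw [hgv, hx]; rfl⟩
      intro j hj
      have : w = ⟨n j, hT.ne_u j⟩ := Subtype.ext hj
      have h2 := hinv (Sum.inl v)
      rw [hx, this, hl] at h2
      cases h2
    · exfalso
      have h2 := hinv (Sum.inl v)
      rw [hx, hr] at h2
      exact hv m (congrArg Subtype.val (Sum.inl.inj h2)).symm
  refine ⟨g, ⟨?_, ?_⟩, ?_⟩
  · rintro v ⟨hv1, hv2⟩
    obtain ⟨w, h1, h2, h3⟩ := hin ⟨v, hv1⟩ hv2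
    obtain ⟨w', h1', h2', h3'⟩ := hin w h2
    change g v = w at h3
    have h4 := hadj (Sum.inl ⟨v, hv1⟩)
    rw [h1, hT.ll] at h4
    rw [h3]
    refine ⟨⟨w.2, h2⟩, h4, ?_⟩
    rw [h3']
    rw [← h1, hinv] at h1'
    exact congrArg Subtype.val (Sum.inl.inj h1').symm
  · intro v hv
    exact dif_neg hv
  · funext x
    rcases x with v | j
    · by_cases hv : ∃ j, v.1 = n j
      · obtain ⟨j, hj⟩ := hv
        have : v = ⟨n j, hT.ne_u j⟩ := Subtype.ext hj
        rw [this, liftC_n hT, hl]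
      · push Not at hv
        obtain ⟨w, h1, h2, h3⟩ := hin v hv
        rw [liftC_o g v hv, h3, h1, Lft_ne _ w.2]
    · simp only [liftC, Set.mem_univ, if_true]
      rw [hr, Lft_ne]

lemma tri_count [Finite V] (hT : Tri G u n T) :
    Nat.card {f // Mt T Set.univ f} =
      Nat.card {f // Mt G Set.univ f} + Nat.card {f // Mt G {v | v ≠ u ∧ ∀ j, v ≠ n j} f} := by
  have hidx : ∀ g : {f // Mt G Set.univ f}, ∃ i, g.1 u = n i := fun g =>
    (hT.adj_u _).1 (g.2.1 u (Set.mem_univ _)).2.1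
  choose idx hidx using hidx
  rw [← Nat.card_sum]
  symm
  let F : {f // Mt G Set.univ f} ⊕ {f // Mt G {v | v ≠ u ∧ ∀ j, v ≠ n j} f} →
      {f // Mt T Set.univ f} := Sum.elim
    (fun g => ⟨liftA u n (idx g) g.1, liftA_mt hT (by simp) (by simp) (Set.mem_univ _) g.2 (hidx g)⟩)
    (fun g => ⟨liftC u n Set.univ id g.1, liftC_mt hT
      (by
        rintro ⟨v, hv⟩
        simp only [Set.mem_univ, Set.mem_ofPred_eq, true_and, true_iff]
        by_cases h : ∃ j, v = n j
        · exact Or.inr h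
        · push Not at h; exact Or.inl ⟨hv, h⟩)
      (fun j _ => ⟨fun h => h.2 j rfl, Set.mem_univ _⟩)
      (fun j h => absurd (Set.mem_univ j) h) (fun j h => absurd (Set.mem_univ j) h)
      (fun h => h.1 rfl) g.2⟩)
  have hAC : ∀ (i : Fin 3) (g g' : V → V), liftA u n i g ≠ liftC u n Set.univ id g' := by
    intro i g g' h
    have h1 := congrFun h (Sum.inr (i+1))
    have h2 : i + 1 ≠ i := by clear * -; revert i; decide
    simp only [liftA, liftC, if_neg h2, Set.mem_univ, if_true] at h1
    rw [Lft_ne _ (hT.ne_u _)] at h1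
    cases h1
  refine Nat.card_congr (Equiv.ofBijective F ⟨?_, ?_⟩)
  · rintro (g | g) (g' | g') h
    · have h1 : liftA u n (idx g) g.1 = liftA u n (idx g') g'.1 := congrArg Subtype.val h
      have h2 : idx g = idx g' := by
        by_contra hne
        have h3 := congrFun h1 (Sum.inr (idx g))
        simp only [liftA, if_true, if_neg hne] at h3
        rw [Lft_ne _ (hT.ne_u _)] at h3
        cases h3
      congr 1
      apply Subtype.ext
      funext v
      by_cases hv : v = u
      · rw [hv, hidx, hidx, h2]
      · have h3 := congrFun h1 (Sum.inl ⟨v, hv⟩)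
        simp only [liftA, h2] at h3
        exact Lft_inj _ _ h3
    · exact absurd (congrArg Subtype.val h) (hAC _ _ _)
    · exact absurd (congrArg Subtype.val h).symm (hAC _ _ _)
    · have h1 : liftC u n Set.univ id g.1 = liftC u n Set.univ id g'.1 := congrArg Subtype.val h
      congr 1
      apply Subtype.ext
      funext v
      by_cases hv : v ≠ u ∧ ∀ j, v ≠ n j
      · have h3 := congrFun h1 (Sum.inl ⟨v, hv.1⟩)
        rw [liftC_o _ _ hv.2, liftC_o _ _ hv.2] at h3
        exact Lft_inj _ _ h3
      · rw [g.2.2 v hv, g'.2.2 v hv]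
  · rintro ⟨h, hh⟩
    by_cases hjk : ∃ j k : Fin 3, h (Sum.inr j) = Sum.inr k
    · obtain ⟨j, k, hjk⟩ := hjk
      obtain ⟨g, i, hg, hi, hgh⟩ := surjA hT hh hjk
      refine ⟨Sum.inl ⟨g, hg⟩, Subtype.ext ?_⟩
      have : idx ⟨g, hg⟩ = i := hT.inj _ _ ((hidx ⟨g, hg⟩).symm.trans hi)
      change liftA u n (idx ⟨g, hg⟩) g = h
      rw [this, hgh]
    · push Not at hjk
      obtain ⟨g, hg, hgh⟩ := surjC hT hh hjk
      exact ⟨Sum.inr ⟨g, hg⟩, Subtype.ext hgh⟩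

end tri2

/-- If `G` is an extremal brick and `u` is a vertex of degree 3 in `G`
with neighbors `a`, `b`, `c`, such that `G − u − N(u)` has exactly one perfect
matching, then the triangle-insertion `G⟨u⟩` is an extremal brick. -/
theorem stmt1 {V : Type*} [Fintype V] [DecidableEq V] (G : SimpleGraph V)
    (u a b c : V) (hab : a ≠ b) (hac : a ≠ c) (hbc : b ≠ c)
    (hN : G.neighborSet u = {a, b, c})
    (hG : IsBrick G) (hext : IsExtremal G)
    (huniq : numPM (G.induce {v : V | v ≠ u ∧ v ∉ G.neighborSet u}) = 1) :
    IsBrick (triangleInsert G u a b c) ∧ IsExtremal (triangleInsert G u a b c) := by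
  have hadj : ∀ v, G.Adj u v ↔ v = a ∨ v = b ∨ v = c := by
    intro v
    have : v ∈ G.neighborSet u ↔ v ∈ ({a, b, c} : Set V) := by rw [hN]
    simpa using this
  have hT : Tri G u (nb a b c) (triangleInsert G u a b c) := by
    refine ⟨?_, ?_, ?_, tri_ll G u a b c, tri_lr G u a b c, tri_rl G u a b c, tri_rr G u a b c⟩
    · intro i j h
      fin_cases i <;> fin_cases j <;> simp_all [nb]
    · intro v
      rw [hadj]
      simp [nb, Fin.exists_fin_succ]
    · intro j h
      apply G.irrefl (v := u)
      rw [hadj, ← h]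
      fin_cases j <;> simp [nb]
  have hset : {v : V | v ≠ u ∧ v ∉ G.neighborSet u} = {v | v ≠ u ∧ ∀ j, v ≠ nb a b c j} := by
    ext v
    simp only [Set.mem_ofPred_eq, mem_neighborSet, hT.adj_u, not_exists, ne_eq]
  have hcard : Fintype.card ({v : V // v ≠ u} ⊕ Fin 3) = Fintype.card V + 2 := by
    have h1 : Fintype.card {v : V // v ≠ u} = Fintype.card V - 1 := by
      simp
    have h2 := hG.1.1
    rw [Fintype.card_sum, h1, Fintype.card_fin]
    omega
  refine ⟨⟨⟨?_, ?_⟩, ?_⟩, ?_⟩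
  · have := hG.1.1
    omega
  · exact tri_conn hT hG.1.2
  · intro p q hpq
    rw [exPM_ind]
    exact tri_bicrit hT (fun x y hxy => (exPM_ind _ _).1 (hG.2 x y hxy)) p q hpq
  · unfold _root_.IsExtremal at hext ⊢
    rw [numPM_ind, hset] at huniq
    rw [numPM_univ] at hext ⊢
    rw [tri_count hT, huniq, tri_edges hT, hcard]
    omega
end

section
/- For every integer t ≥ 1, the graph G'_t is a brick, where G'_t is defined as follows: G_t has vertex set {u_s^j : 0 ≤ s ≤ t, 1 ≤ j ≤ 4} ∪ {u}, with edges u_s^1 u_s^2, u_s^2 u_s^3, u_s^3 u_s^4 for each 0 ≤ s ≤ t, edges u_s^1 u_{s+1}^1 and u_s^4 u_{s+1}^3 for each 0 ≤ s ≤ t−1, and edges u u_t^1 and u u_t^4; setting S = {u_0^1, u_0^3, u} ∪ {u_s^2, u_s^4 : 0 ≤ s ≤ t}, G'_t is obtained from G_t by adding a new vertex u' adjacent to every vertex of S. -/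
open SimpleGraph

/-- The set `S = {u₀¹, u₀³, u} ∪ {uₛ², uₛ⁴ : 0 ≤ s ≤ t}` of vertices of `G_t`
(here `Sum.inl (s, j)` is the vertex `u_s^{j+1}` and `Sum.inr false` is `u`;
`Sum.inr true` will be the extra vertex `u'` of `G'_t`). -/
def Sset (t : ℕ) : Set ((Fin (t + 1) × Fin 4) ⊕ Bool) :=
  {p | p = Sum.inl (0, 0) ∨ p = Sum.inl (0, 2) ∨ p = Sum.inr false ∨
       ∃ s : Fin (t + 1), p = Sum.inl (s, 1) ∨ p = Sum.inl (s, 3)}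

/-- The graph `G'_t`: the vertex `Sum.inl (s, j)` is `u_s^{j+1}`, `Sum.inr false` is `u`
and `Sum.inr true` is `u'`.  The edges are the path edges `u_s^1 u_s^2 u_s^3 u_s^4`
for `0 ≤ s ≤ t`, the edges `u_s^1 u_{s+1}^1` and `u_s^4 u_{s+1}^3` for `0 ≤ s ≤ t−1`,
the edges `u u_t^1` and `u u_t^4`, and the edges from `u'` to every vertex of `S`. -/
def G't (t : ℕ) : SimpleGraph ((Fin (t + 1) × Fin 4) ⊕ Bool) :=
  SimpleGraph.fromRel (fun p q =>
    (∃ (s : Fin (t + 1)) (j j' : Fin 4), (j' : ℕ) = (j : ℕ) + 1 ∧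
        p = Sum.inl (s, j) ∧ q = Sum.inl (s, j')) ∨
    (∃ s s' : Fin (t + 1), (s' : ℕ) = (s : ℕ) + 1 ∧
        ((p = Sum.inl (s, 0) ∧ q = Sum.inl (s', 0)) ∨
         (p = Sum.inl (s, 3) ∧ q = Sum.inl (s', 2)))) ∨
    (p = Sum.inl (Fin.last t, 0) ∧ q = Sum.inr false) ∨
    (p = Sum.inl (Fin.last t, 3) ∧ q = Sum.inr false) ∨
    (p ∈ Sset t ∧ q = Sum.inr true))

/-- `P` is perfectly matched in `G`, the matching being given by an involution. -/
def PMon {V : Type*} (G : SimpleGraph V) (P : V → Prop) : Prop :=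
  ∃ f : V → V, ∀ v, P v → P (f v) ∧ f (f v) = v ∧ G.Adj v (f v)

/-- Deleting `x, y` leaves no nontrivial cut. -/
def Cn {V : Type*} (G : SimpleGraph V) (x y : V) : Prop :=
  ∀ P : V → Prop,
    (∀ p q, p ≠ x → p ≠ y → q ≠ x → q ≠ y → G.Adj p q → (P p ↔ P q)) →
    ∀ p q, p ≠ x → p ≠ y → q ≠ x → q ≠ y → (P p ↔ P q)

theorem Cn.symm {V : Type*} {G : SimpleGraph V} {x y : V} (h : Cn G x y) : Cn G y x := by
  intro P hP p q h1 h2 h3 h4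
  exact h P (fun p q a b c d => hP p q b a d c) p q h2 h1 h4 h3

theorem PMon.congr {V : Type*} {G : SimpleGraph V} {P Q : V → Prop} (h : PMon G P)
    (hPQ : ∀ v, Q v ↔ P v) : PMon G Q := by
  obtain rfl : Q = P := funext fun v => propext (hPQ v)
  exact h

theorem PMon.add {V : Type*} {G : SimpleGraph V} {P : V → Prop} (h : PMon G P) {p q : V}
    (hpq : G.Adj p q) (hp : ¬ P p) (hq : ¬ P q) : PMon G (fun v => P v ∨ v = p ∨ v = q) := by
  classical
  obtain ⟨f, hf⟩ := h
  have hne := hpq.ne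
  refine ⟨fun v => if v = p then q else if v = q then p else f v, ?_⟩
  intro v hv
  by_cases h1 : v = p
  · subst h1; simp [hne.symm, hpq]
  by_cases h2 : v = q
  · subst h2; simp [hne.symm, hpq.symm]
  have hv' : P v := by tauto
  obtain ⟨a, b, c⟩ := hf v hv'
  have h3 : f v ≠ p := fun e => hp (e ▸ a)
  have h4 : f v ≠ q := fun e => hq (e ▸ a)
  simp [h1, h2, h3, h4, a, b, c]

theorem PMon.remove {V : Type*} {G : SimpleGraph V} {P : V → Prop} (h : PMon G P) {p : V}
    (hp : P p) : ∃ q, P q ∧ G.Adj p q ∧ PMon G (fun v => P v ∧ v ≠ p ∧ v ≠ q) := by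
  obtain ⟨f, hf⟩ := h
  refine ⟨f p, (hf p hp).1, (hf p hp).2.2, f, ?_⟩
  rintro v ⟨h1, h2, h3⟩
  obtain ⟨a, b, c⟩ := hf v h1
  refine ⟨⟨a, ?_, ?_⟩, b, c⟩
  · rintro e; apply h3; rw [← e, b]
  · rintro e; apply h2; rw [← b, e, (hf p hp).2.1]

theorem PMon.map {V W : Type*} {G : SimpleGraph V} {H : SimpleGraph W} {P : V → Prop}
    (h : PMon G P) (e : V → W) (he : Function.Injective e)
    (hadj : ∀ p q, P p → P q → G.Adj p q → H.Adj (e p) (e q)) :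
    PMon H (fun w => ∃ v, w = e v ∧ P v) := by
  classical
  obtain ⟨f, hf⟩ := h
  refine ⟨fun w => if hw : ∃ v, w = e v then e (f hw.choose) else w, ?_⟩
  have key : ∀ v, (if hw : ∃ u, e v = e u then e (f hw.choose) else e v) = e (f v) := by
    intro v
    have hw : ∃ u, e v = e u := ⟨v, rfl⟩
    rw [dif_pos hw, ← he hw.choose_spec]
  rintro w ⟨v, rfl, hv⟩
  obtain ⟨a, b, c⟩ := hf v hv
  dsimp only
  rw [key, key, b]
  exact ⟨⟨_, rfl, a⟩, rfl, hadj _ _ hv a c⟩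

/-- The invariant carried by the induction. -/
structure Good {V : Type*} (G : SimpleGraph V) (h α γ : V) : Prop where
  hα : h ≠ α
  hγ : h ≠ γ
  αγ : α ≠ γ
  hu : ∃ u, G.Adj h u ∧ u ≠ α ∧ u ≠ γ
  nα : ∃ p q, p ≠ q ∧ p ≠ h ∧ q ≠ h ∧ G.Adj α p ∧ G.Adj α q
  nγ : ∃ p q, p ≠ q ∧ p ≠ h ∧ q ≠ h ∧ G.Adj γ p ∧ G.Adj γ q
  cn : ∀ x y, Cn G x y
  pm : ∀ x y, x ≠ y → PMon G (fun v => v ≠ x ∧ v ≠ y)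

/-- `H` arises from `G` by inserting the path `a b c d` at `h`. -/
structure GExt {V W : Type*} (G : SimpleGraph V) (h α γ : V) (H : SimpleGraph W)
    (e : V → W) (a b c d : W) : Prop where
  inj : Function.Injective e
  cover : ∀ w, (∃ v, w = e v) ∨ w = a ∨ w = b ∨ w = c ∨ w = d
  ea : ∀ v, e v ≠ a
  eb : ∀ v, e v ≠ b
  ec : ∀ v, e v ≠ c
  ed : ∀ v, e v ≠ d
  nab : a ≠ b
  nac : a ≠ c
  nad : a ≠ d
  nbc : b ≠ c
  nbd : b ≠ d
  ncd : c ≠ d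
  ab : H.Adj a b
  bc : H.Adj b c
  cd : H.Adj c d
  ha : H.Adj (e h) a
  hb : H.Adj (e h) b
  hc : H.Adj (e h) c
  hd : H.Adj (e h) d
  aα : H.Adj a (e α)
  dγ : H.Adj d (e γ)
  old : ∀ p q, G.Adj p q → p ≠ h → q ≠ h → H.Adj (e p) (e q)
  oldh : ∀ q, G.Adj h q → q ≠ α → q ≠ γ → H.Adj (e h) (e q)

/-- Reflection symmetry of the gadget. -/
theorem GExt.flip {V W : Type*} {G : SimpleGraph V} {h α γ : V} {H : SimpleGraph W}
    {e : V → W} {a b c d : W} (E : GExt G h α γ H e a b c d) : GExt G h γ α H e d c b a where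
  inj := E.inj
  cover := fun w => by have := E.cover w; tauto
  ea := E.ed
  eb := E.ec
  ec := E.eb
  ed := E.ea
  nab := E.ncd.symm
  nac := E.nbd.symm
  nad := E.nad.symm
  nbc := E.nbc.symm
  nbd := E.nac.symm
  ncd := E.nab.symm
  ab := E.cd.symm
  bc := E.bc.symm
  cd := E.ab.symm
  ha := E.hd
  hb := E.hc
  hc := E.hb
  hd := E.ha
  aα := E.dγ
  dγ := E.aα
  old := E.old
  oldh := fun q h1 h2 h3 => E.oldh q h1 h3 h2

theorem Good.flip {V : Type*} {G : SimpleGraph V} {h α γ : V} (g : Good G h α γ) :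
    Good G h γ α := by
  obtain ⟨u, h1, h2, h3⟩ := g.hu
  exact ⟨g.hγ, g.hα, g.αγ.symm, ⟨u, h1, h3, h2⟩, g.nγ, g.nα, g.cn, g.pm⟩

theorem PMon.add2 {V : Type*} {G : SimpleGraph V} {P : V → Prop} (h : PMon G P) {p q r s : V}
    (hpq : G.Adj p q) (hrs : G.Adj r s) (hp : ¬ P p) (hq : ¬ P q) (hr : ¬ P r) (hs : ¬ P s)
    (h1 : r ≠ p) (h2 : r ≠ q) (h3 : s ≠ p) (h4 : s ≠ q) :
    PMon G (fun v => (P v ∨ v = p ∨ v = q) ∨ v = r ∨ v = s) :=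
  (h.add hpq hp hq).add hrs (by tauto) (by tauto)

theorem GExt.pmBase {V W : Type*} {G : SimpleGraph V} {h α γ : V} {H : SimpleGraph W}
    {e : V → W} {a b c d : W} (E : GExt G h α γ H e a b c d) (g : Good G h α γ) (v : V)
    (hv : v ≠ h) : PMon H (fun w => ∃ u, w = e u ∧ u ≠ h ∧ u ≠ v) :=
  (g.pm h v hv.symm).map e E.inj (fun p q hp hq hpq => E.old p q hpq hp.1 hq.1)

/-- two old vertices removed -/
theorem GExt.pm_old {V W : Type*} {G : SimpleGraph V} {h α γ : V} {H : SimpleGraph W}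
    {e : V → W} {a b c d : W} (E : GExt G h α γ H e a b c d) (g : Good G h α γ) (x y : V)
    (hxy : x ≠ y) : PMon H (fun w => w ≠ e x ∧ w ≠ e y) := by
  obtain ⟨inj, cover, ea, eb, ec, ed, nab, nac, nad, nbc, nbd, ncd, ab, bc, cd, ha, hb, hc, hd,
    aα, dγ, old, oldh⟩ := id E
  have hα := g.hα
  have hγ := g.hγ
  have αγ := g.αγ
  have inj' : ∀ u v, e u = e v ↔ u = v := fun u v => inj.eq_iff
  by_cases hx : x = h
  · subst hx
    refine ((E.pmBase g y hxy.symm).add2 ab cd ?_ ?_ ?_ ?_ ?_ ?_ ?_ ?_).congr ?_ <;>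
      (try (intro w; have hw := cover w)) <;> grind
  by_cases hy : y = h
  · subst hy
    refine ((E.pmBase g x hxy).add2 ab cd ?_ ?_ ?_ ?_ ?_ ?_ ?_ ?_).congr ?_ <;>
      (try (intro w; have hw := cover w)) <;> grind
  obtain ⟨z, hz, hhz, M⟩ := (g.pm x y hxy).remove (p := h) ⟨Ne.symm hx, Ne.symm hy⟩
  have M' := M.map e inj (fun p q hp hq hpq => old p q hpq hp.2.1 hq.2.1)
  have hzh := hhz.ne
  by_cases hzα : z = α
  · subst hzα
    refine ((M'.add2 aα bc ?_ ?_ ?_ ?_ ?_ ?_ ?_ ?_).add hd ?_ ?_).congr ?_ <;>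
      (try (intro w; have hw := cover w)) <;> grind
  by_cases hzγ : z = γ
  · subst hzγ
    refine ((M'.add2 dγ bc ?_ ?_ ?_ ?_ ?_ ?_ ?_ ?_).add ha ?_ ?_).congr ?_ <;>
      (try (intro w; have hw := cover w)) <;> grind
  have hh := oldh z hhz hzα hzγ
  refine ((M'.add2 ab cd ?_ ?_ ?_ ?_ ?_ ?_ ?_ ?_).add hh ?_ ?_).congr ?_ <;>
      (try (intro w; have hw := cover w)) <;> grind

/-- an old vertex and `a` or `b` removed -/
theorem GExt.pm_mixed {V W : Type*} {G : SimpleGraph V} {h α γ : V} {H : SimpleGraph W}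
    {e : V → W} {a b c d : W} (E : GExt G h α γ H e a b c d) (g : Good G h α γ) (x : V) :
    PMon H (fun w => w ≠ e x ∧ w ≠ a) ∧ PMon H (fun w => w ≠ e x ∧ w ≠ b) := by
  obtain ⟨inj, cover, ea, eb, ec, ed, nab, nac, nad, nbc, nbd, ncd, ab, bc, cd, ha, hb, hc, hd,
    aα, dγ, old, oldh⟩ := id E
  have hα := g.hα
  have hγ := g.hγ
  have αγ := g.αγ
  have inj' : ∀ u v, e u = e v ↔ u = v := fun u v => inj.eq_iff
  by_cases hx : x = h
  · subst hx
    constructor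
    · refine ((E.pmBase g γ hγ.symm).add2 bc dγ ?_ ?_ ?_ ?_ ?_ ?_ ?_ ?_).congr ?_ <;>
      (try (intro w; have hw := cover w)) <;> grind
    · refine ((E.pmBase g α hα.symm).add2 cd aα ?_ ?_ ?_ ?_ ?_ ?_ ?_ ?_).congr ?_ <;>
      (try (intro w; have hw := cover w)) <;> grind
  constructor
  · refine ((E.pmBase g x hx).add2 bc hd ?_ ?_ ?_ ?_ ?_ ?_ ?_ ?_).congr ?_ <;>
      (try (intro w; have hw := cover w)) <;> grind
  · refine ((E.pmBase g x hx).add2 cd ha ?_ ?_ ?_ ?_ ?_ ?_ ?_ ?_).congr ?_ <;>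
      (try (intro w; have hw := cover w)) <;> grind

/-- two new vertices removed -/
theorem GExt.pm_new {V W : Type*} {G : SimpleGraph V} {h α γ : V} {H : SimpleGraph W}
    {e : V → W} {a b c d : W} (E : GExt G h α γ H e a b c d) (g : Good G h α γ) :
    PMon H (fun w => w ≠ a ∧ w ≠ b) ∧ PMon H (fun w => w ≠ a ∧ w ≠ c) ∧
    PMon H (fun w => w ≠ a ∧ w ≠ d) ∧ PMon H (fun w => w ≠ b ∧ w ≠ c) := by
  obtain ⟨inj, cover, ea, eb, ec, ed, nab, nac, nad, nbc, nbd, ncd, ab, bc, cd, ha, hb, hc, hd,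
    aα, dγ, old, oldh⟩ := id E
  have hα := g.hα
  have hγ := g.hγ
  have αγ := g.αγ
  have inj' : ∀ u v, e u = e v ↔ u = v := fun u v => inj.eq_iff
  obtain ⟨u, hu, hu1, hu2⟩ := g.hu
  have huh := hu.ne
  have hh := oldh u hu hu1 hu2
  refine ⟨?_, ?_, ?_, ?_⟩
  · refine ((E.pmBase g u huh.symm).add2 cd hh ?_ ?_ ?_ ?_ ?_ ?_ ?_ ?_).congr ?_ <;>
      (try (intro w; have hw := cover w)) <;> grind
  · refine ((E.pmBase g γ hγ.symm).add2 dγ hb ?_ ?_ ?_ ?_ ?_ ?_ ?_ ?_).congr ?_ <;>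
      (try (intro w; have hw := cover w)) <;> grind
  · refine ((E.pmBase g u huh.symm).add2 bc hh ?_ ?_ ?_ ?_ ?_ ?_ ?_ ?_).congr ?_ <;>
      (try (intro w; have hw := cover w)) <;> grind
  · refine ((E.pmBase g α hα.symm).add2 aα hd ?_ ?_ ?_ ?_ ?_ ?_ ?_ ?_).congr ?_ <;>
      (try (intro w; have hw := cover w)) <;> grind

theorem GExt.pm {V W : Type*} {G : SimpleGraph V} {h α γ : V} {H : SimpleGraph W}
    {e : V → W} {a b c d : W} (E : GExt G h α γ H e a b c d) (g : Good G h α γ) (x y : W)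
    (hxy : x ≠ y) : PMon H (fun w => w ≠ x ∧ w ≠ y) := by
  have m1 := fun v => (E.pm_mixed g v).1
  have m2 := fun v => (E.pm_mixed g v).2
  have m3 := fun v => (E.flip.pm_mixed g.flip v).2
  have m4 := fun v => (E.flip.pm_mixed g.flip v).1
  obtain ⟨n1, n2, n3, n4⟩ := E.pm_new g
  obtain ⟨n5, n6, -, -⟩ := E.flip.pm_new g.flip
  have sw : ∀ {p q : W}, PMon H (fun w => w ≠ p ∧ w ≠ q) → PMon H (fun w => w ≠ q ∧ w ≠ p) :=
    fun hh => hh.congr (fun v => and_comm)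
  rcases E.cover x with ⟨v, rfl⟩ | rfl | rfl | rfl | rfl <;>
  rcases E.cover y with ⟨v', rfl⟩ | rfl | rfl | rfl | rfl <;>
  first
  | exact absurd rfl hxy
  | exact E.pm_old g _ _ (fun hh => hxy (hh ▸ rfl))
  | exact m1 _
  | exact m2 _
  | exact m3 _
  | exact m4 _
  | exact sw (m1 _)
  | exact sw (m2 _)
  | exact sw (m3 _)
  | exact sw (m4 _)
  | assumption
  | (apply sw; assumption)

theorem Cn.of_base {V : Type*} {G : SimpleGraph V} {x y : V}
    (h : ∀ P : V → Prop,
      (∀ p q, p ≠ x → p ≠ y → q ≠ x → q ≠ y → G.Adj p q → (P p ↔ P q)) →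
      ∃ R : Prop, ∀ p, p ≠ x → p ≠ y → (P p ↔ R)) : Cn G x y := by
  intro P hP p q h1 h2 h3 h4
  obtain ⟨R, hR⟩ := h P hP
  rw [hR p h1 h2, hR q h3 h4]

theorem GExt.cn_oldh {V W : Type*} {G : SimpleGraph V} {h α γ : V} {H : SimpleGraph W}
    {e : V → W} {a b c d : W} (E : GExt G h α γ H e a b c d) (g : Good G h α γ) (y : V) :
    Cn H (e h) (e y) := by
  obtain ⟨inj, cover, ea, eb, ec, ed, nab, nac, nad, nbc, nbd, ncd, ab, bc, cd, ha, hb, hc, hd,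
    aα, dγ, old, oldh⟩ := id E
  apply Cn.of_base
  intro P hP
  have K := g.cn h y (fun v => P (e v)) (fun p q h1 h2 h3 h4 h5 =>
    hP _ _ (inj.ne h1) (inj.ne h2) (inj.ne h3) (inj.ne h4) (old p q h5 h1 h3))
  have k1 := hP a b (ea _).symm (ea _).symm (eb _).symm (eb _).symm ab
  have k2 := hP b c (eb _).symm (eb _).symm (ec _).symm (ec _).symm bc
  have k3 := hP c d (ec _).symm (ec _).symm (ed _).symm (ed _).symm cd
  refine ⟨P a, ?_⟩
  have R : ∃ r, r ≠ h ∧ r ≠ y ∧ (P (e r) ↔ P a) := by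
    by_cases hy : α = y
    · have hγy : γ ≠ y := fun hh => g.αγ (hy.trans hh.symm)
      refine ⟨γ, g.hγ.symm, hγy, ?_⟩
      have := hP d (e γ) (ed _).symm (ed _).symm (inj.ne g.hγ.symm) (inj.ne hγy) dγ
      tauto
    · refine ⟨α, g.hα.symm, hy, ?_⟩
      exact (hP a (e α) (ea _).symm (ea _).symm (inj.ne g.hα.symm) (inj.ne hy) aα).symm
  obtain ⟨r, r1, r2, r3⟩ := R
  intro w h1 h2
  rcases cover w with ⟨v, rfl⟩ | rfl | rfl | rfl | rfl
  · have := K v r (fun hh => h1 (hh ▸ rfl)) (fun hh => h2 (hh ▸ rfl)) r1 r2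
    tauto
  all_goals tauto

theorem GExt.cn_old {V W : Type*} {G : SimpleGraph V} {h α γ : V} {H : SimpleGraph W}
    {e : V → W} {a b c d : W} (E : GExt G h α γ H e a b c d) (g : Good G h α γ) (x y : V) :
    Cn H (e x) (e y) := by
  by_cases hx : h = x
  · subst hx; exact E.cn_oldh g y
  by_cases hy : h = y
  · subst hy; exact (E.cn_oldh g x).symm
  obtain ⟨inj, cover, ea, eb, ec, ed, nab, nac, nad, nbc, nbd, ncd, ab, bc, cd, ha, hb, hc, hd,
    aα, dγ, old, oldh⟩ := id E
  apply Cn.of_base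
  intro P hP
  have k1 := hP _ _ (inj.ne hx) (inj.ne hy) (ea _).symm (ea _).symm ha
  have k2 := hP _ _ (inj.ne hx) (inj.ne hy) (eb _).symm (eb _).symm hb
  have k3 := hP _ _ (inj.ne hx) (inj.ne hy) (ec _).symm (ec _).symm hc
  have k4 := hP _ _ (inj.ne hx) (inj.ne hy) (ed _).symm (ed _).symm hd
  have hub : ∀ q, q ≠ x → q ≠ y → G.Adj h q → (P (e h) ↔ P (e q)) := by
    intro q h3 h4 h5
    by_cases q1 : q = α
    · subst q1
      have := hP _ _ (ea _).symm (ea _).symm (inj.ne h3) (inj.ne h4) aα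
      tauto
    by_cases q2 : q = γ
    · subst q2
      have := hP _ _ (ed _).symm (ed _).symm (inj.ne h3) (inj.ne h4) dγ
      tauto
    exact hP _ _ (inj.ne hx) (inj.ne hy) (inj.ne h3) (inj.ne h4) (oldh q h5 q1 q2)
  have K := g.cn x y (fun v => P (e v)) (by
    intro p q h1 h2 h3 h4 h5
    by_cases hp : p = h
    · subst hp; exact hub q h3 h4 h5
    by_cases hq : q = h
    · subst hq; exact (hub p h1 h2 h5.symm).symm
    exact hP _ _ (inj.ne h1) (inj.ne h2) (inj.ne h3) (inj.ne h4) (old p q h5 hp hq))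
  refine ⟨P (e h), ?_⟩
  intro w h1 h2
  rcases cover w with ⟨v, rfl⟩ | rfl | rfl | rfl | rfl
  · exact K v h (fun hh => h1 (hh ▸ rfl)) (fun hh => h2 (hh ▸ rfl)) hx hy
  all_goals tauto

theorem GExt.cn_mixed {V W : Type*} {G : SimpleGraph V} {h α γ : V} {H : SimpleGraph W}
    {e : V → W} {a b c d : W} (E : GExt G h α γ H e a b c d) (g : Good G h α γ) (x : V)
    (y : W) (hy : y = a ∨ y = b) : Cn H (e x) y := by
  obtain ⟨inj, cover, ea, eb, ec, ed, nab, nac, nad, nbc, nbd, ncd, ab, bc, cd, ha, hb, hc, hd,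
    aα, dγ, old, oldh⟩ := id E
  have ey : ∀ v, e v ≠ y := by rcases hy with rfl | rfl <;> assumption
  have cy : c ≠ y := by rcases hy with rfl | rfl <;> [exact nac.symm; exact nbc.symm]
  have dy : d ≠ y := by rcases hy with rfl | rfl <;> [exact nad.symm; exact nbd.symm]
  apply Cn.of_base
  intro P hP
  have kcd := hP c d (ec _).symm cy (ed _).symm dy cd
  by_cases hx : h = x
  · subst hx
    have K := g.cn h h (fun v => P (e v)) (fun p q h1 h2 h3 h4 h5 =>
      hP _ _ (inj.ne h1) (ey _) (inj.ne h3) (ey _) (old p q h5 h1 h3))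
    have kd := hP d (e γ) (ed _).symm dy (inj.ne g.hγ.symm) (ey _) dγ
    have kαγ := K α γ g.hα.symm g.hα.symm g.hγ.symm g.hγ.symm
    refine ⟨P d, ?_⟩
    intro w h1 h2
    rcases cover w with ⟨v, rfl⟩ | rfl | rfl | rfl | rfl
    · have hv : v ≠ h := fun hh => h1 (hh ▸ rfl)
      have := K v γ hv hv g.hγ.symm g.hγ.symm
      tauto
    · have := hP _ _ h1 h2 (inj.ne g.hα.symm) (ey _) aα
      tauto
    · have := hP _ _ h1 h2 (ec _).symm cy bc
      tauto
    all_goals tauto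
  · have kc := hP _ _ (inj.ne hx) (ey _) (ec _).symm cy hc
    have kd := hP _ _ (inj.ne hx) (ey _) (ed _).symm dy hd
    have hub : ∀ q, q ≠ x → q ≠ α → G.Adj h q → (P (e h) ↔ P (e q)) := by
      intro q h3 h4 h5
      by_cases q2 : q = γ
      · subst q2
        have := hP _ _ (ed _).symm dy (inj.ne h3) (ey _) dγ
        tauto
      exact hP _ _ (inj.ne hx) (ey _) (inj.ne h3) (ey _) (oldh q h5 h4 q2)
    have K := g.cn x α (fun v => P (e v)) (by
      intro p q h1 h2 h3 h4 h5
      by_cases hp : p = h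
      · subst hp; exact hub q h3 h4 h5
      by_cases hq : q = h
      · subst hq; exact (hub p h1 h2 h5.symm).symm
      exact hP _ _ (inj.ne h1) (ey _) (inj.ne h3) (ey _) (old p q h5 hp hq))
    have Kα : α ≠ x → (P (e α) ↔ P (e h)) := by
      intro hα
      obtain ⟨p, q, pq, ph, qh, ap, aq⟩ := g.nα
      have : ∃ r, r ≠ x ∧ r ≠ h ∧ G.Adj α r := by
        by_cases hp : p = x
        · exact ⟨q, fun hh => pq (hp.trans hh.symm), qh, aq⟩
        · exact ⟨p, hp, ph, ap⟩
      obtain ⟨r, r1, r2, r3⟩ := this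
      have e1 := hP _ _ (inj.ne hα) (ey _) (inj.ne r1) (ey _) (old α r r3 g.hα.symm r2)
      have e2 := K r h r1 r3.ne' hx g.hα
      exact e1.trans e2
    refine ⟨P (e h), ?_⟩
    intro w h1 h2
    rcases cover w with ⟨v, rfl⟩ | rfl | rfl | rfl | rfl
    · have hv : v ≠ x := fun hh => h1 (hh ▸ rfl)
      by_cases hvα : v = α
      · subst hvα; exact Kα hv
      · exact K v h hv hvα hx g.hα
    · exact (hP _ _ (inj.ne hx) (ey _) h1 h2 ha).symm
    · exact (hP _ _ (inj.ne hx) (ey _) h1 h2 hb).symm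
    · exact kc.symm
    · exact kd.symm

theorem GExt.cn_new {V W : Type*} {G : SimpleGraph V} {h α γ : V} {H : SimpleGraph W}
    {e : V → W} {a b c d : W} (E : GExt G h α γ H e a b c d) (g : Good G h α γ)
    (x y : W) (ex : ∀ v, e v ≠ x) (ey : ∀ v, e v ≠ y) : Cn H x y := by
  obtain ⟨inj, cover, ea, eb, ec, ed, nab, nac, nad, nbc, nbd, ncd, ab, bc, cd, ha, hb, hc, hd,
    aα, dγ, old, oldh⟩ := id E
  apply Cn.of_base
  intro P hP
  have K := g.cn h h (fun v => P (e v)) (fun p q h1 h2 h3 h4 h5 =>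
      hP _ _ (ex _) (ey _) (ex _) (ey _) (old p q h5 h1 h3))
  obtain ⟨u, hu, u1, u2⟩ := g.hu
  have ku := hP _ _ (ex _) (ey _) (ex _) (ey _) (oldh u hu u1 u2)
  refine ⟨P (e h), ?_⟩
  intro w h1 h2
  rcases cover w with ⟨v, rfl⟩ | rfl | rfl | rfl | rfl
  · by_cases hv : v = h
    · subst hv; rfl
    · have := K v u hv hv hu.ne' hu.ne'
      tauto
  · exact (hP _ _ (ex _) (ey _) h1 h2 ha).symm
  · exact (hP _ _ (ex _) (ey _) h1 h2 hb).symm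
  · exact (hP _ _ (ex _) (ey _) h1 h2 hc).symm
  · exact (hP _ _ (ex _) (ey _) h1 h2 hd).symm

theorem GExt.cn {V W : Type*} {G : SimpleGraph V} {h α γ : V} {H : SimpleGraph W}
    {e : V → W} {a b c d : W} (E : GExt G h α γ H e a b c d) (g : Good G h α γ) (x y : W) :
    Cn H x y := by
  have key : ∀ w, (∃ v, w = e v) ∨ ((∀ v, e v ≠ w) ∧ ∀ v, Cn H (e v) w) := by
    intro w
    rcases E.cover w with hv | rfl | rfl | rfl | rfl
    · exact Or.inl hv
    · exact Or.inr ⟨E.ea, fun v => E.cn_mixed g v _ (Or.inl rfl)⟩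
    · exact Or.inr ⟨E.eb, fun v => E.cn_mixed g v _ (Or.inr rfl)⟩
    · exact Or.inr ⟨E.ec, fun v => E.flip.cn_mixed g.flip v _ (Or.inr rfl)⟩
    · exact Or.inr ⟨E.ed, fun v => E.flip.cn_mixed g.flip v _ (Or.inl rfl)⟩
  rcases key x with ⟨v, rfl⟩ | ⟨hx, hx'⟩ <;> rcases key y with ⟨v', rfl⟩ | ⟨hy, hy'⟩
  · exact E.cn_old g _ _
  · exact hy' v
  · exact (hx' v').symm
  · exact E.cn_new g x y hx hy

theorem GExt.good {V W : Type*} {G : SimpleGraph V} {h α γ : V} {H : SimpleGraph W}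
    {e : V → W} {a b c d : W} (E : GExt G h α γ H e a b c d) (g : Good G h α γ) :
    Good H (e h) a c where
  hα := E.ea h
  hγ := E.ec h
  αγ := E.nac
  hu := ⟨b, E.hb, E.nab.symm, E.nbc⟩
  nα := ⟨b, e α, (E.eb _).symm, (E.eb _).symm, E.inj.ne g.hα.symm, E.ab, E.aα⟩
  nγ := ⟨b, d, E.nbd, (E.eb _).symm, (E.ed _).symm, E.bc.symm, E.cd⟩
  cn := E.cn g
  pm := E.pm g

/-! ### The base case: the wheel on six vertices -/

/-- adjacency of the wheel with hub `5` and rim `0 1 2 3 4` -/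
def wheelRel (i j : Fin 6) : Bool :=
  (i ≠ j) && (i = 5 || j = 5 || (i.val + 1) % 5 = j.val || (j.val + 1) % 5 = i.val)

theorem wheel_pm : ∀ x y : Fin 6, x ≠ y → ∃ p q, wheelRel p q = true ∧
    ∃ r s, wheelRel r s = true ∧ r ≠ p ∧ r ≠ q ∧ s ≠ p ∧ s ≠ q ∧
      ∀ w, (w ≠ x ∧ w ≠ y) ↔ ((False ∨ w = p ∨ w = q) ∨ w = r ∨ w = s) := by
  decide +kernel

set_option synthInstance.maxHeartbeats 400000 in
set_option synthInstance.maxSize 4000 in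
theorem wheel_cn : ∀ x y : Fin 6, ∀ P : Fin 6 → Bool,
    (∀ p q, p ≠ x → p ≠ y → q ≠ x → q ≠ y → wheelRel p q = true → P p = P q) →
    ∀ p q, p ≠ x → p ≠ y → q ≠ x → q ≠ y → P p = P q := by
  decide +kernel

theorem wheel_good {W : Type*} (H : SimpleGraph W) (f : Fin 6 → W)
    (hf : Function.Bijective f) (hadj : ∀ i j, wheelRel i j = true → H.Adj (f i) (f j)) :
    Good H (f 5) (f 0) (f 2) := by
  classical
  obtain ⟨inj, surj⟩ := hf
  refine ⟨inj.ne (by decide), inj.ne (by decide), inj.ne (by decide),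
    ⟨f 1, hadj _ _ (by decide), inj.ne (by decide), inj.ne (by decide)⟩,
    ⟨f 1, f 4, inj.ne (by decide), inj.ne (by decide), inj.ne (by decide),
      hadj _ _ (by decide), hadj _ _ (by decide)⟩,
    ⟨f 1, f 3, inj.ne (by decide), inj.ne (by decide), inj.ne (by decide),
      hadj _ _ (by decide), hadj _ _ (by decide)⟩, ?_, ?_⟩
  · intro x y P hP p q
    obtain ⟨x, rfl⟩ := surj x
    obtain ⟨y, rfl⟩ := surj y
    obtain ⟨p, rfl⟩ := surj p
    obtain ⟨q, rfl⟩ := surj q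
    intro h1 h2 h3 h4
    have := wheel_cn x y (fun i => decide (P (f i))) (by
      intro p q h1 h2 h3 h4 h5
      simpa using hP _ _ (inj.ne h1) (inj.ne h2) (inj.ne h3) (inj.ne h4) (hadj _ _ h5)) p q
      (fun h => h1 (h ▸ rfl)) (fun h => h2 (h ▸ rfl)) (fun h => h3 (h ▸ rfl))
      (fun h => h4 (h ▸ rfl))
    simpa using this
  · intro x y hxy
    obtain ⟨x, rfl⟩ := surj x
    obtain ⟨y, rfl⟩ := surj y
    obtain ⟨p, q, h1, r, s, h2, h3, h4, h5, h6, h7⟩ := wheel_pm x y (fun h => hxy (h ▸ rfl))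
    have hE : PMon H (fun _ => False) := ⟨id, fun v hv => hv.elim⟩
    refine (hE.add2 (hadj _ _ h1) (hadj _ _ h2) id id id id (inj.ne h3) (inj.ne h4)
      (inj.ne h5) (inj.ne h6)).congr ?_
    intro w
    obtain ⟨w, rfl⟩ := surj w
    have := h7 w
    simpa only [ne_eq, inj.eq_iff] using this

/-! ### The graphs `G't` -/

/-- inclusion of the vertices of `G't t` into those of `G't (t+1)` -/
def shiftV (t : ℕ) : (Fin (t + 1) × Fin 4) ⊕ Bool → (Fin (t + 1 + 1) × Fin 4) ⊕ Bool
  | Sum.inl (s, j) => Sum.inl (s.succ, j)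
  | Sum.inr b => Sum.inr b

theorem ext_G't (t : ℕ) : GExt (G't t) (Sum.inr true) (Sum.inl (0, 0)) (Sum.inl (0, 2))
    (G't (t + 1)) (shiftV t) (Sum.inl (0, 0)) (Sum.inl (0, 1)) (Sum.inl (0, 2))
    (Sum.inl (0, 3)) where
  inj := by
    rintro (⟨s, j⟩ | b) (⟨s', j'⟩ | b') <;> simp [shiftV]
  cover := by
    rintro (⟨s, j⟩ | b)
    · refine Fin.cases ?_ (fun s => ?_) s
      · right; fin_cases j <;> simp
      · left; exact ⟨Sum.inl (s, j), rfl⟩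
    · left; exact ⟨Sum.inr b, rfl⟩
  ea := by rintro (⟨s, j⟩ | b) <;> simp [shiftV]
  eb := by rintro (⟨s, j⟩ | b) <;> simp [shiftV]
  ec := by rintro (⟨s, j⟩ | b) <;> simp [shiftV]
  ed := by rintro (⟨s, j⟩ | b) <;> simp [shiftV]
  nab := by simp
  nac := by simp
  nad := by simp
  nbc := by simp
  nbd := by simp
  ncd := by simp
  ab := by simp [G't]
  bc := by simp [G't]
  cd := by simp [G't]
  ha := by simp [G't, shiftV, Sset]
  hb := by simp [G't, shiftV, Sset]
  hc := by simp [G't, shiftV, Sset]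
  hd := by simp [G't, shiftV, Sset]
  aα := by simp [G't, shiftV, Sset]
  dγ := by simp [G't, shiftV, Sset]
  old := by
    rintro (⟨s, j⟩ | _ | _) (⟨s', j'⟩ | _ | _) <;>
      simp [G't, shiftV, Sset, ← Fin.succ_last] <;> grind
  oldh := by
    rintro (⟨s, j⟩ | _ | _) <;>
      simp [G't, shiftV, Sset]
    grind

/-- the six vertices of `G't 0` -/
def baseV : Fin 6 → (Fin (0 + 1) × Fin 4) ⊕ Bool :=
  ![Sum.inl (0, 0), Sum.inl (0, 1), Sum.inl (0, 2), Sum.inl (0, 3), Sum.inr false, Sum.inr true]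

theorem good_G't (t : ℕ) :
    Good (G't t) (Sum.inr true) (Sum.inl (0, 0)) (Sum.inl (0, 2)) := by
  induction t with
  | zero =>
    refine wheel_good (G't 0) baseV ⟨by decide, by decide⟩ ?_
    intro i j
    fin_cases i <;> fin_cases j <;> simp [wheelRel, G't, baseV, Sset, Fin.last]
  | succ t ih => exact (ext_G't t).good ih

theorem PMon.toSubgraph {V : Type*} {G : SimpleGraph V} {P : V → Prop} (h : PMon G P) :
    ∃ M : (G.induce {v : V | P v}).Subgraph, M.IsPerfectMatching := by
  obtain ⟨f, hf⟩ := h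
  refine ⟨{ verts := Set.univ
            Adj := fun p q => f p.1 = q.1
            adj_sub := ?_
            edge_vert := fun _ => Set.mem_univ _
            symm := ?_ }, ?_⟩
  · intro p q hpq
    have := (hf p.1 p.2).2.2
    rw [hpq] at this
    exact this
  · refine ⟨?_⟩
    intro p q hpq
    rw [← hpq]; exact (hf p.1 p.2).2.1
  · rw [Subgraph.isPerfectMatching_iff]
    intro p
    refine ⟨⟨f p.1, (hf p.1 p.2).1⟩, rfl, ?_⟩
    intro q hq
    exact Subtype.ext (Eq.symm (show f p.1 = q.1 from hq))

theorem connected_of_cut {V : Type*} {G : SimpleGraph V} {s : Set V} (hne : ∃ v, v ∉ s)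
    (h : ∀ P : V → Prop, (∀ p q, p ∉ s → q ∉ s → G.Adj p q → (P p ↔ P q)) →
      ∀ p q, p ∉ s → q ∉ s → (P p ↔ P q)) : (G.induce (sᶜ : Set V)).Connected := by
  obtain ⟨v, hv⟩ := hne
  have : Nonempty ↥(sᶜ : Set V) := ⟨⟨v, hv⟩⟩
  refine ⟨?_⟩
  rintro ⟨p, hp⟩ ⟨q, hq⟩
  have := h (fun w => ∃ hw : w ∈ (sᶜ : Set V), (G.induce (sᶜ : Set V)).Reachable ⟨p, hp⟩ ⟨w, hw⟩)
    (by
      intro a b ha hb hab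
      have hab' : (G.induce (sᶜ : Set V)).Adj ⟨a, ha⟩ ⟨b, hb⟩ := hab
      constructor
      · rintro ⟨_, hr⟩; exact ⟨hb, hr.trans hab'.reachable⟩
      · rintro ⟨_, hr⟩; exact ⟨ha, hr.trans hab'.symm.reachable⟩) p q hp hq
  exact (this.1 ⟨hp, Reachable.refl _⟩).2

theorem brick_of {V : Type*} [Fintype V] {G : SimpleGraph V} (hc : 4 ≤ Fintype.card V)
    (cn : ∀ x y, Cn G x y) (pm : ∀ x y, x ≠ y → PMon G (fun v => v ≠ x ∧ v ≠ y)) :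
    IsBrick G := by
  classical
  refine ⟨⟨hc, ?_⟩, fun x y hxy => (pm x y hxy).toSubgraph⟩
  have big : ∀ s : Set V, s.ncard ≤ 2 → ∃ v, v ∉ s := by
    intro s hs
    by_contra hcon
    push Not at hcon
    have : s = Set.univ := Set.eq_univ_of_forall hcon
    rw [this, Set.ncard_univ, Nat.card_eq_fintype_card] at hs
    omega
  have pair : ∀ x y : V, (G.induce (({x, y} : Set V)ᶜ : Set V)).Connected := by
    intro x y
    refine connected_of_cut (big _ ((Set.ncard_insert_le x {y}).trans (by simp))) ?_
    intro P hP p q hp hq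
    simp only [Set.mem_insert_iff, Set.mem_singleton_iff, not_or] at hP hp hq
    exact cn x y P (fun p q a b c d e => hP p q ⟨a, b⟩ ⟨c, d⟩ e) p q hp.1 hp.2 hq.1 hq.2
  intro s hs
  obtain h0 | h1 | h2 : s.ncard = 0 ∨ s.ncard = 1 ∨ s.ncard = 2 := by omega
  · refine connected_of_cut (big s hs) ?_
    rw [Set.ncard_eq_zero] at h0
    subst h0
    intro P hP p q _ _
    obtain ⟨x, hx⟩ := big {p, q} ((Set.ncard_insert_le p {q}).trans (by simp))
    simp only [Set.mem_insert_iff, Set.mem_singleton_iff, not_or] at hx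
    exact cn x x P (fun p q _ _ _ _ e => hP p q (by simp) (by simp) e) p q
      (Ne.symm hx.1) (Ne.symm hx.1) (Ne.symm hx.2) (Ne.symm hx.2)
  · obtain ⟨x, rfl⟩ := Set.ncard_eq_one.1 h1
    have := pair x x
    rwa [Set.pair_eq_singleton] at this
  · obtain ⟨x, y, -, rfl⟩ := Set.ncard_eq_two.1 h2
    exact pair x y

/-- For every integer `t ≥ 1`, the graph `G'_t` is a brick. -/
theorem stmt5 (t : ℕ) (ht : 1 ≤ t) : IsBrick (G't t) := by
  have g := good_G't t
  refine brick_of ?_ g.cn g.pm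
  simp
  omega
end

section
/- For every even integer n ≥ 18, writing n = i + 8(t+1) with t ≥ 1 an integer and 0 < i ≤ 8, the graph G''_n = G'_t⟨S_{i/2}⟩ is a brick on n vertices. -/
open SimpleGraph

/-- The sets `S₁ = S \ {u_t², u_t⁴, u}`, `S₂ = S \ {u_t⁴, u}`, `S₃ = S \ {u}`, `S₄ = S`. -/
def Ssub (t : ℕ) : ℕ → Set ((Fin (t + 1) × Fin 4) ⊕ Bool)
  | 1 => Sset t \ {Sum.inl (Fin.last t, 1), Sum.inl (Fin.last t, 3), Sum.inr false}
  | 2 => Sset t \ {Sum.inl (Fin.last t, 3), Sum.inr false}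
  | 3 => Sset t \ {Sum.inr false}
  | _ => Sset t

/-- Vertices of the graph obtained from `G` by simultaneous triangle-insertions at all
vertices of `S'`: a vertex is either `(v, none)` for an untouched vertex `v ∉ S'`, or
`(v, some w)` for `v ∈ S'` and `w` a neighbor of `v`, the triangle vertex of `v`
facing `w`.  (When every vertex of `S'` has degree 3, each `v ∈ S'` is replaced by
a triangle whose vertex facing `w` is joined to `w`.) -/
abbrev ExpandVerts {V : Type*} (G : SimpleGraph V) (S' : Set V) : Type _ :=
  {p : V × Option V //
    (p.1 ∉ S' ∧ p.2 = none) ∨ (p.1 ∈ S' ∧ ∃ w, p.2 = some w ∧ G.Adj p.1 w)}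

noncomputable instance expandVertsFintype {V : Type*} [Fintype V] (G : SimpleGraph V)
    (S' : Set V) : Fintype (ExpandVerts G S') := by
  classical exact Subtype.fintype _

/-- The graph obtained from `G` by triangle-insertions at all vertices of `S'`:
two untouched vertices are adjacent iff they were adjacent in `G`; the triangle
vertex of `v` facing `w` is adjacent to the other two triangle vertices of `v`,
and to `w` (to the triangle vertex of `w` facing `v`, if `w ∈ S'`). -/
def expand {V : Type*} (G : SimpleGraph V) (S' : Set V) :
    SimpleGraph (ExpandVerts G S') :=
  SimpleGraph.fromRel (fun p q =>
    (p.1.2 = none ∧ q.1.2 = none ∧ G.Adj p.1.1 q.1.1) ∨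
    (p.1.2 = none ∧ q.1.2 = some p.1.1) ∨
    (∃ w w' : V, p.1.2 = some w ∧ q.1.2 = some w' ∧
      ((p.1.1 = q.1.1 ∧ w ≠ w') ∨ (q.1.1 = w ∧ p.1.1 = w'))))

namespace Brick

/-- The set `A` carries a perfect matching of `G` restricted to `A`. -/
def PMon {V : Type*} (G : SimpleGraph V) (A : Set V) : Prop :=
  ∃ f : V → V, ∀ v ∈ A, f v ∈ A ∧ G.Adj v (f v) ∧ f (f v) = v

theorem PMon.empty {V : Type*} (G : SimpleGraph V) : PMon G ∅ :=
  ⟨id, fun _ h => h.elim⟩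

theorem PMon.congr {V : Type*} {G : SimpleGraph V} {A B : Set V} (h : PMon G A) (e : B = A) :
    PMon G B := e ▸ h

theorem PMon.pair {V : Type*} {G : SimpleGraph V} {a b : V} (h : G.Adj a b) :
    PMon G {a, b} := by
  classical
  refine ⟨fun v => if v = a then b else a, ?_⟩
  have := h.ne
  have := h.symm
  rintro v (rfl | rfl) <;> simp_all [h.ne.symm]

theorem PMon.sUnion {V : Type*} {G : SimpleGraph V} (c : Set (Set V))
    (hc : ∀ A ∈ c, PMon G A) (hd : ∀ A ∈ c, ∀ B ∈ c, ∀ x, x ∈ A → x ∈ B → A = B) :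
    PMon G (⋃₀ c) := by
  classical
  have : Nonempty (V → V) := ⟨id⟩
  choose! f hf using hc
  have hex : ∀ v, ∃ A, v ∈ ⋃₀ c → A ∈ c ∧ v ∈ A := by
    intro v
    by_cases h : v ∈ ⋃₀ c
    · obtain ⟨A, hA, hv⟩ := h
      exact ⟨A, fun _ => ⟨hA, hv⟩⟩
    · exact ⟨∅, fun h' => (h h').elim⟩
  choose g hg using hex
  refine ⟨fun v => f (g v) v, fun v hv => ?_⟩
  obtain ⟨h1, h2⟩ := hg v hv
  obtain ⟨h3, h4, h5⟩ := hf _ h1 v h2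
  have h6 : f (g v) v ∈ ⋃₀ c := ⟨g v, h1, h3⟩
  obtain ⟨h7, h8⟩ := hg _ h6
  have h9 : g (f (g v) v) = g v := hd _ h7 _ h1 _ h8 h3
  refine ⟨h6, h4, ?_⟩
  simp only [h9, h5]

theorem PMon.union {V : Type*} {G : SimpleGraph V} {A B : Set V} (hA : PMon G A) (hB : PMon G B)
    (hd : Disjoint A B) : PMon G (A ∪ B) := by
  rw [Set.disjoint_left] at hd
  refine (PMon.sUnion {A, B} ?_ ?_).congr (by simp)
  · rintro _ (rfl | rfl) <;> assumption
  · rintro _ (rfl | rfl) _ (rfl | rfl) x h1 h2 <;> first | rfl | exact (hd h1 h2).elim | exact (hd h2 h1).elim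

/-- Reachability within `A`. -/
def Reach {V : Type*} (G : SimpleGraph V) (A : Set V) : V → V → Prop :=
  Relation.ReflTransGen (fun a b => G.Adj a b ∧ a ∈ A ∧ b ∈ A)

theorem Reach.mono {V : Type*} {G : SimpleGraph V} {A B : Set V} (h : A ⊆ B) {a b : V}
    (r : Reach G A a b) : Reach G B a b :=
  Relation.ReflTransGen.mono (p := fun a b => G.Adj a b ∧ a ∈ B ∧ b ∈ B)
    (fun _ _ h' => ⟨h'.1, h h'.2.1, h h'.2.2⟩) _ _ r

theorem Reach.symm {V : Type*} {G : SimpleGraph V} {A : Set V} {a b : V}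
    (r : Reach G A a b) : Reach G A b a := by
  induction r with
  | refl => exact .refl
  | tail _ h ih => exact Relation.ReflTransGen.head ⟨h.1.symm, h.2.2, h.2.1⟩ ih

theorem Reach.trans {V : Type*} {G : SimpleGraph V} {A : Set V} {a b c : V}
    (r : Reach G A a b) (r' : Reach G A b c) : Reach G A a c :=
  Relation.ReflTransGen.trans r r'

theorem Reach.single {V : Type*} {G : SimpleGraph V} {A : Set V} {a b : V}
    (h : G.Adj a b) (ha : a ∈ A) (hb : b ∈ A) : Reach G A a b :=
  Relation.ReflTransGen.single ⟨h, ha, hb⟩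

theorem Reach.rfl' {V : Type*} {G : SimpleGraph V} {A : Set V} {a : V} : Reach G A a a :=
  Relation.ReflTransGen.refl

def ConnOn {V : Type*} (G : SimpleGraph V) (A : Set V) : Prop :=
  ∀ p ∈ A, ∀ q ∈ A, Reach G A p q

/-- Bicritical and (essentially) 3-connected. -/
def Good {V : Type*} (G : SimpleGraph V) : Prop :=
  (∀ x y, x ≠ y → PMon G {x, y}ᶜ) ∧ ∀ x y, ConnOn G {x, y}ᶜ

/-- Conditions on the fibre over `v` of a blow up. -/
structure FibOK {V W : Type*} (H : SimpleGraph W) (π : W → V) (v : V) : Prop where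
  conn : ConnOn H (π ⁻¹' {v})
  fact : ∀ x, π x = v → PMon H (π ⁻¹' {v} \ {x})
  fact3 : ∀ x y, x ≠ y → π x = v → π y = v → ∃ z z', π z = v ∧ z ≠ x ∧ z ≠ y ∧ π z' ≠ v ∧
    H.Adj z z' ∧ PMon H (π ⁻¹' {v} \ {x, y, z})
  out : ∀ x p, p ≠ x → π x = v → π p = v → ∃ z, H.Adj p z ∧ π z ≠ v
  out2 : ∀ x p, p ≠ x → π x = v → π p = v → ∀ b, ∃ q z, Reach H (π ⁻¹' {v} \ {x}) p q ∧
    π q = v ∧ q ≠ x ∧ H.Adj q z ∧ π z ≠ v ∧ π z ≠ b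

theorem good_blow {V W : Type*} {H : SimpleGraph W} {G : SimpleGraph V} (π : W → V)
    (hG : Good G) (lift : ∀ v w, G.Adj v w → ∃ p q, π p = v ∧ π q = w ∧ H.Adj p q)
    (fib : ∀ v, FibOK H π v) : Good H := by
  classical
  have edge : ∀ p q, H.Adj p q → π p ≠ π q → PMon H (π ⁻¹' {π p, π q}) := by
    intro p q h hne
    have h1 := ((fib (π p)).fact p rfl).union ((fib (π q)).fact q rfl) (by
      rw [Set.disjoint_left]; intro a ha hb
      simp only [Set.mem_sdiff, Set.mem_preimage, Set.mem_singleton_iff] at ha hb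
      exact hne (ha.1.symm.trans hb.1))
    have h2 := h1.union (PMon.pair h) (by
      rw [Set.disjoint_left]; intro a ha hb
      simp only [Set.mem_sdiff, Set.mem_preimage, Set.mem_singleton_iff, Set.mem_union,
        Set.mem_insert_iff] at ha hb
      rcases hb with rfl | rfl <;> rcases ha with ha | ha
      · exact ha.2 rfl
      · exact hne ha.1
      · exact hne ha.1.symm
      · exact ha.2 rfl)
    refine h2.congr ?_
    ext a
    simp only [Set.mem_sdiff, Set.mem_preimage, Set.mem_singleton_iff, Set.mem_union,
        Set.mem_insert_iff]
    by_cases a = p <;> by_cases a = q <;> simp_all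
  have main : ∀ a b, a ≠ b → PMon H (π ⁻¹' {a, b}ᶜ) := by
    intro a b hab
    obtain ⟨f, hf⟩ := hG.1 a b hab
    refine (PMon.sUnion {A | ∃ v, v ∈ ({a, b}ᶜ : Set V) ∧ A = π ⁻¹' {v, f v}} ?_ ?_).congr ?_
    · rintro _ ⟨v, hv, rfl⟩
      obtain ⟨h1, h2, h3⟩ := hf v hv
      obtain ⟨p, q, hp, hq, h⟩ := lift _ _ h2
      have := edge p q h (by rw [hp, hq]; exact h2.ne)
      rwa [hp, hq] at this
    · rintro _ ⟨v, hv, rfl⟩ _ ⟨w, hw, rfl⟩ x hx hy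
      obtain ⟨h1, h2, h3⟩ := hf v hv
      obtain ⟨h1', h2', h3'⟩ := hf w hw
      simp only [Set.mem_preimage, Set.mem_insert_iff, Set.mem_singleton_iff] at hx hy
      have : ({v, f v} : Set V) = {w, f w} := by
        rcases hx with hx | hx <;> rcases hy with hy | hy
        · rw [← hx, ← hy]
        · have : v = f w := hx.symm.trans hy
          rw [this, h3', Set.pair_comm]
        · have : f v = w := hx.symm.trans hy
          rw [← this, h3, Set.pair_comm]
        · have : f v = f w := hx.symm.trans hy
          have h4 : v = w := by rw [← h3, this, h3']
          rw [h4]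
      rw [this]
    · ext x
      constructor
      · intro hx
        exact ⟨_, ⟨π x, hx, rfl⟩, by simp⟩
      · rintro ⟨_, ⟨v, hv, rfl⟩, hx⟩
        rcases hx with hx | hx
        · simp only [Set.mem_preimage]; rw [hx]; exact hv
        · simp only [Set.mem_preimage]; rw [hx]; exact (hf v hv).1
  refine ⟨?_, ?_⟩
  · intro x y hxy
    by_cases hπ : π x = π y
    · obtain ⟨z, z', hz, hzx, hzy, hz', hadj, hpm⟩ := (fib (π x)).fact3 x y hxy rfl hπ.symm
      have h1 := main (π x) (π z') (Ne.symm hz')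
      have h2 := (h1.union hpm (by
        rw [Set.disjoint_left]; intro a ha hb
        exact ha (Or.inl hb.1))).union ((fib (π z')).fact z' rfl) (by
        rw [Set.disjoint_left]; rintro a (ha | ha) hb
        · exact ha (Or.inr hb.1)
        · exact hz' (hb.1.symm.trans ha.1))
      have h3 := h2.union (PMon.pair hadj) (by
        rw [Set.disjoint_left]; rintro a ((ha | ha) | ha) (rfl | rfl)
        · exact ha (Or.inl hz)
        · exact ha (Or.inr rfl)
        · exact ha.2 (by simp)
        · exact hz' ha.1
        · exact hz' (ha.1.symm.trans hz)
        · exact ha.2 rfl)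
      refine h3.congr ?_
      ext a
      simp only [Set.mem_compl_iff, Set.mem_insert_iff, Set.mem_singleton_iff, Set.mem_union,
        Set.mem_preimage, Set.mem_sdiff]
      grind
    · have h1 := main (π x) (π y) hπ
      have h2 := (h1.union ((fib (π x)).fact x rfl) (by
        rw [Set.disjoint_left]; intro a ha hb
        exact ha (Or.inl hb.1))).union ((fib (π y)).fact y rfl) (by
        rw [Set.disjoint_left]; rintro a (ha | ha) hb
        · exact ha (Or.inr hb.1)
        · exact hπ (ha.1.symm.trans hb.1))
      refine h2.congr ?_
      ext a
      simp only [Set.mem_compl_iff, Set.mem_insert_iff, Set.mem_singleton_iff, Set.mem_union,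
        Set.mem_preimage, Set.mem_sdiff]
      grind
  · intro x y
    have sub : ∀ v, v ∈ ({π x, π y}ᶜ : Set V) → π ⁻¹' {v} ⊆ ({x, y}ᶜ : Set W) := by
      rintro v hv a ha (rfl | rfl)
      · exact hv (Or.inl (by simpa using ha.symm))
      · exact hv (Or.inr (by simpa using ha.symm))
    have step1 : ∀ v w, v ∈ ({π x, π y}ᶜ : Set V) → Reach G {π x, π y}ᶜ v w →
        ∀ p q, π p = v → π q = w → Reach H {x, y}ᶜ p q := by
      intro v w hv r
      induction r with
      | refl =>
        intro p q hp hq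
        exact ((fib v).conn p hp q hq).mono (sub v hv)
      | tail r h ih =>
        intro p q hp hq
        obtain ⟨p', q', hp', hq', h'⟩ := lift _ _ h.1
        exact ((ih p p' hp hp').trans (Reach.single h' (sub _ h.2.1 hp') (sub _ h.2.2 hq'))).trans
          (((fib _).conn q' hq' q hq).mono (sub _ h.2.2))
    have aux : ∀ x y p, p ∈ ({x, y}ᶜ : Set W) → π p = π x →
        ∃ q, π q ∈ ({π x, π y}ᶜ : Set V) ∧ Reach H {x, y}ᶜ p q := by
      intro x y p hp hx
      simp only [Set.mem_compl_iff, Set.mem_insert_iff, Set.mem_singleton_iff, not_or] at hp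
      by_cases hy : π y = π x
      · obtain ⟨z, hz, hz'⟩ := (fib (π x)).out x p hp.1 rfl hx
        refine ⟨z, by simp [hy, hz'], Reach.single hz (by simp [hp]) ?_⟩
        rintro (rfl | rfl)
        · exact hz' rfl
        · exact hz' hy
      · obtain ⟨q, z, hr, hq, hqx, had, hzx, hzb⟩ := (fib (π x)).out2 x p hp.1 rfl hx (π y)
        refine ⟨z, by simp [hzx, hzb], (hr.mono ?_).trans (Reach.single had ?_ ?_)⟩
        · rintro a ⟨ha, ha'⟩ (rfl | rfl)
          · exact ha' rfl
          · exact hy ha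
        · rintro (rfl | rfl)
          · exact hqx rfl
          · exact hy hq
        · rintro (rfl | rfl)
          · exact hzx rfl
          · exact hzb rfl
    have step2 : ∀ p, p ∈ ({x, y}ᶜ : Set W) →
        ∃ q, π q ∈ ({π x, π y}ᶜ : Set V) ∧ Reach H {x, y}ᶜ p q := by
      intro p hp
      by_cases h1 : π p = π x
      · exact aux x y p hp h1
      by_cases h2 : π p = π y
      · rw [Set.pair_comm x y] at hp ⊢
        rw [Set.pair_comm (π x)]
        exact aux y x p hp h2
      · exact ⟨p, by simp [h1, h2], Reach.rfl'⟩
    intro p hp q hq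
    obtain ⟨p', hp', rp⟩ := step2 p hp
    obtain ⟨q', hq', rq⟩ := step2 q hq
    exact (rp.trans (step1 _ _ hp' (hG.2 _ _ _ hp' _ hq') p' q' rfl rfl)).trans rq.symm

theorem fib_single {V W : Type*} {H : SimpleGraph W} {π : W → V} {v : V}
    (h : ∀ x y, π x = v → π y = v → x = y) : FibOK H π v where
  conn p hp q hq := by rw [h p q hp hq]; exact Reach.rfl'
  fact x hx := (PMon.empty H).congr (by
    ext a; simp only [Set.mem_sdiff, Set.mem_preimage, Set.mem_singleton_iff, Set.mem_empty_iff_false,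
      iff_false, not_and, not_not]
    intro ha; exact h _ _ ha hx)
  fact3 x y hxy hx hy := (hxy (h _ _ hx hy)).elim
  out x y hxy hx hy := (hxy (h _ _ hy hx)).elim
  out2 x y hxy hx hy := (hxy (h _ _ hy hx)).elim

theorem fib_tri {V W : Type*} {H : SimpleGraph W} {π : W → V} {v : V} (c o : Fin 3 → W)
    (hc : Function.Injective c) (hr : ∀ x, π x = v ↔ ∃ i, x = c i)
    (hadj : ∀ i j, i ≠ j → H.Adj (c i) (c j)) (ho : ∀ i, H.Adj (c i) (o i))
    (hov : ∀ i, π (o i) ≠ v) (hoi : Function.Injective (fun i => π (o i))) : FibOK H π v where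
  conn p hp q hq := by
    obtain ⟨i, rfl⟩ := (hr p).1 hp
    obtain ⟨j, rfl⟩ := (hr q).1 hq
    by_cases h : i = j
    · rw [h]; exact Reach.rfl'
    · exact Reach.single (hadj i j h) hp hq
  fact x hx := by
    obtain ⟨i, rfl⟩ := (hr x).1 hx
    refine (PMon.pair (hadj (i+1) (i+2) (by clear hx; revert i; decide))).congr ?_
    ext a
    simp only [Set.mem_sdiff, Set.mem_preimage, Set.mem_singleton_iff, Set.mem_insert_iff, hr]
    constructor
    · rintro ⟨⟨j, rfl⟩, h⟩
      rw [hc.eq_iff] at h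
      rw [hc.eq_iff, hc.eq_iff]
      clear hx; revert i j; decide
    · rintro (rfl | rfl)
      · exact ⟨⟨_, rfl⟩, by rw [hc.eq_iff]; clear hx; revert i; decide⟩
      · exact ⟨⟨_, rfl⟩, by rw [hc.eq_iff]; clear hx; revert i; decide⟩
  fact3 x y hxy hx hy := by
    obtain ⟨i, rfl⟩ := (hr x).1 hx
    obtain ⟨j, rfl⟩ := (hr y).1 hy
    have hij : i ≠ j := fun h => hxy (by rw [h])
    obtain ⟨k, hk, hki, hkj⟩ : ∃ k, (∀ l, l = i ∨ l = j ∨ l = k) ∧ k ≠ i ∧ k ≠ j := by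
      clear hx hy hxy; revert i j; decide
    refine ⟨c k, o k, (hr _).2 ⟨k, rfl⟩, hc.ne hki, hc.ne hkj, hov k, ho k, (PMon.empty H).congr ?_⟩
    ext a
    simp only [Set.mem_sdiff, Set.mem_preimage, Set.mem_singleton_iff, Set.mem_insert_iff, hr,
      Set.mem_empty_iff_false, iff_false, not_and, not_not]
    rintro ⟨l, rfl⟩
    rw [hc.eq_iff, hc.eq_iff, hc.eq_iff]
    exact hk l
  out x p hxp hx hp := by
    obtain ⟨i, rfl⟩ := (hr p).1 hp
    exact ⟨o i, ho i, hov i⟩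
  out2 x p hxp hx hp b := by
    obtain ⟨i, rfl⟩ := (hr x).1 hx
    obtain ⟨j, rfl⟩ := (hr p).1 hp
    have hij : j ≠ i := fun h => hxp (by rw [h])
    by_cases hb : π (o j) = b
    · obtain ⟨k, hki, hkj⟩ : ∃ k, k ≠ i ∧ k ≠ j := by
        clear hx hp hxp hb; revert i j; decide
      refine ⟨c k, o k, Reach.single (hadj _ _ hkj.symm) ⟨hp, hxp⟩
        ⟨(hr _).2 ⟨k, rfl⟩, hc.ne hki⟩, (hr _).2 ⟨k, rfl⟩, hc.ne hki, ho k, hov k, ?_⟩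
      rw [← hb]
      exact fun h => hkj (hoi h)
    · exact ⟨c j, o j, Reach.rfl', hp, hxp, ho j, hov j, hb⟩

theorem fib_pent {V W : Type*} {H : SimpleGraph W} {π : W → V} {v : V} (c o : Fin 5 → W)
    (hc : Function.Injective c) (hr : ∀ x, π x = v ↔ ∃ i, x = c i)
    (hadj : ∀ i, H.Adj (c i) (c (i + 1))) (ho : ∀ i, H.Adj (c i) (o i))
    (hov : ∀ i, π (o i) ≠ v) (hoi : ∀ i b, ∃ k, k ≠ i ∧ π (o k) ≠ b) : FibOK H π v := by
  have d1 : ∀ i : Fin 5, i + 1 ≠ i ∧ i + 1 + 1 ≠ i ∧ i + 1 + 1 + 1 ≠ i ∧ i + 1 + 1 + 1 + 1 ≠ i := by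
    decide
  have reach : ∀ i j, j ≠ i → Reach H (π ⁻¹' {v} \ {c i}) (c (i + 1)) (c j) := by
    intro i j hij
    have mem : ∀ k, k ≠ i → c k ∈ (π ⁻¹' {v} \ {c i}) :=
      fun k hk => ⟨(hr _).2 ⟨k, rfl⟩, hc.ne hk⟩
    have st : ∀ k, k ≠ i → k + 1 ≠ i → Reach H (π ⁻¹' {v} \ {c i}) (c k) (c (k + 1)) :=
      fun k h1 h2 => Reach.single (hadj k) (mem _ h1) (mem _ h2)
    have r1 := st (i+1) (d1 i).1 (d1 i).2.1
    have r2 := st (i+1+1) (d1 i).2.1 (d1 i).2.2.1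
    have r3 := st (i+1+1+1) (d1 i).2.2.1 (d1 i).2.2.2
    have : j = i+1 ∨ j = i+1+1 ∨ j = i+1+1+1 ∨ j = i+1+1+1+1 := by
      clear r1 r2 r3 mem st; revert i j; decide
    rcases this with rfl | rfl | rfl | rfl
    · exact Reach.rfl'
    · exact r1
    · exact r1.trans r2
    · exact (r1.trans r2).trans r3
  refine ⟨?_, ?_, ?_, ?_, ?_⟩
  · intro p hp q hq
    obtain ⟨i, rfl⟩ := (hr p).1 hp
    obtain ⟨j, rfl⟩ := (hr q).1 hq
    obtain ⟨k, hki, hkj⟩ : ∃ k, i ≠ k ∧ j ≠ k := by clear hp hq; revert i j; decide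
    exact ((reach k i hki).symm.trans (reach k j hkj)).mono Set.sdiff_subset
  · intro x hx
    obtain ⟨i, rfl⟩ := (hr x).1 hx
    refine ((PMon.pair (hadj (i+1))).union (PMon.pair (hadj (i+3))) ?_).congr ?_
    · rw [Set.disjoint_left]
      intro a ha hb
      simp only [Set.mem_singleton_iff, Set.mem_insert_iff] at ha hb
      rcases ha with rfl | rfl <;> rw [hc.eq_iff, hc.eq_iff] at hb <;> clear hx <;> revert i <;> decide
    · ext a
      simp only [Set.mem_sdiff, Set.mem_preimage, Set.mem_singleton_iff, Set.mem_insert_iff, hr,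
        Set.mem_union]
      constructor
      · rintro ⟨⟨j, rfl⟩, h⟩
        rw [hc.eq_iff] at h
        simp only [hc.eq_iff]
        clear hx
        revert i j; decide
      · rintro ((rfl | rfl) | (rfl | rfl)) <;>
        exact ⟨⟨_, rfl⟩, by rw [hc.eq_iff]; clear hx; revert i; decide⟩
  · intro x y hxy hx hy
    obtain ⟨i, rfl⟩ := (hr x).1 hx
    obtain ⟨j, rfl⟩ := (hr y).1 hy
    have hij : i ≠ j := fun h => hxy (by rw [h])
    obtain ⟨k, l, hk, hki, hkj, h1, h2, h3, h4, h5, h6⟩ : ∃ k l : Fin 5,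
      (∀ m, m = i ∨ m = j ∨ m = k ∨ m = l ∨ m = l + 1) ∧ k ≠ i ∧ k ≠ j ∧ l ≠ i ∧ l ≠ j ∧ l ≠ k ∧
        l + 1 ≠ i ∧ l + 1 ≠ j ∧ l + 1 ≠ k := by
      clear hx hy hxy; revert i j; decide
    refine ⟨c k, o k, (hr _).2 ⟨k, rfl⟩, hc.ne hki, hc.ne hkj, hov k, ho k,
      (PMon.pair (hadj l)).congr ?_⟩
    ext a
    simp only [Set.mem_sdiff, Set.mem_preimage, Set.mem_singleton_iff, Set.mem_insert_iff, hr]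
    constructor
    · rintro ⟨⟨m, rfl⟩, h⟩
      simp only [hc.eq_iff] at h ⊢
      have := hk m
      tauto
    · rintro (rfl | rfl)
      · exact ⟨⟨_, rfl⟩, by simp only [hc.eq_iff]; tauto⟩
      · exact ⟨⟨_, rfl⟩, by simp only [hc.eq_iff]; tauto⟩
  · intro x p hxp hx hp
    obtain ⟨i, rfl⟩ := (hr p).1 hp
    exact ⟨o i, ho i, hov i⟩
  · intro x p hxp hx hp b
    obtain ⟨i, rfl⟩ := (hr x).1 hx
    obtain ⟨j, rfl⟩ := (hr p).1 hp
    have hij : j ≠ i := fun h => hxp (by rw [h])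
    obtain ⟨k, hki, hkb⟩ := hoi i b
    exact ⟨c k, o k, (reach i j hij).symm.trans (reach i k hki), (hr _).2 ⟨k, rfl⟩, hc.ne hki,
      ho k, hov k, hkb⟩

theorem isBrick_of_good {V : Type*} [Fintype V] {G : SimpleGraph V} (hG : Good G)
    (hV : 4 ≤ Fintype.card V) : IsBrick G := by
  classical
  have conv : ∀ (A : Set V) (p q : V) (hp : p ∈ A), Reach G A p q → ∃ hq : q ∈ A,
      (G.induce A).Reachable ⟨p, hp⟩ ⟨q, hq⟩ := by
    intro A p q hp r
    induction r with
    | refl => exact ⟨hp, .refl _⟩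
    | tail _ h ih =>
      obtain ⟨h1, h2⟩ := ih
      refine ⟨h.2.2, h2.trans (SimpleGraph.Adj.reachable ?_)⟩
      exact h.1
  have other : ∀ s : Finset V, s.card ≤ 3 → ∃ x, x ∉ s := by
    intro s hs
    by_contra! h
    have : s = Finset.univ := Finset.eq_univ_iff_forall.2 h
    rw [this, Finset.card_univ] at hs
    omega
  refine ⟨⟨hV, ?_⟩, ?_⟩
  · intro s hs
    have key : ConnOn G sᶜ := by
      have hfin : s.Finite := Set.toFinite s
      have h012 : s.ncard = 0 ∨ s.ncard = 1 ∨ s.ncard = 2 := by omega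
      rcases h012 with h | h | h
      · rw [Set.ncard_eq_zero] at h
        subst h
        intro p _ q _
        obtain ⟨x, hx⟩ := other {p, q} (le_trans Finset.card_le_two (by norm_num))
        simp only [Finset.mem_insert, Finset.mem_singleton, not_or] at hx
        exact (hG.2 x x p (by simp [Ne.symm hx.1]) q (by simp [Ne.symm hx.2])).mono (by simp)
      · obtain ⟨x, rfl⟩ := Set.ncard_eq_one.1 h
        simpa using hG.2 x x
      · obtain ⟨x, y, _, rfl⟩ := Set.ncard_eq_two.1 h
        exact hG.2 x y
    have hne : ∃ x, x ∉ s := by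
      obtain ⟨x, hx⟩ := other s.toFinset (by rw [← Set.ncard_eq_toFinset_card']; omega)
      exact ⟨x, by simpa using hx⟩
    obtain ⟨x, hx⟩ := hne
    have : Nonempty ↑(sᶜ) := ⟨⟨x, hx⟩⟩
    refine SimpleGraph.Connected.mk ?_
    rintro ⟨p, hp⟩ ⟨q, hq⟩
    obtain ⟨_, h⟩ := conv _ p q hp (key p hp q hq)
    exact h
  · intro x y hxy
    obtain ⟨f, hf⟩ := hG.1 x y hxy
    have e : ∀ v, v ∈ {v : V | v ≠ x ∧ v ≠ y} ↔ v ∈ ({x, y}ᶜ : Set V) := by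
      intro v; simp
    refine ⟨{ verts := Set.univ, Adj := fun a b => f a.1 = b.1 ∧ f b.1 = a.1, adj_sub := ?_,
              edge_vert := fun _ => trivial, symm := ⟨fun a b h => ⟨h.2, h.1⟩⟩ }, ?_⟩
    · rintro ⟨a, ha⟩ ⟨b, hb⟩ ⟨h1, h2⟩
      simp only at h1 h2
      subst h1
      exact (hf a ((e a).1 ha)).2.1
    · rw [SimpleGraph.Subgraph.isPerfectMatching_iff]
      rintro ⟨v, hv⟩
      obtain ⟨h1, h2, h3⟩ := hf v ((e v).1 hv)
      refine ⟨⟨f v, (e _).2 h1⟩, ⟨rfl, h3⟩, ?_⟩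
      rintro ⟨w, hw⟩ ⟨h, _⟩
      exact Subtype.ext h.symm

/-- Every vertex of `S'` has exactly three neighbours. -/
def Cubic {V : Type*} (G : SimpleGraph V) (S' : Set V) : Prop :=
  ∀ v ∈ S', ∃ n : Fin 3 → V, Function.Injective n ∧ ∀ w, G.Adj v w ↔ ∃ i, w = n i

open Classical in
/-- The vertex in the fibre of `v` facing `w`. -/
noncomputable def tow {V : Type*} (G : SimpleGraph V) (S' : Set V) (v w : V) (h : G.Adj v w) :
    ExpandVerts G S' :=
  if hv : v ∈ S' then ⟨(v, some w), Or.inr ⟨hv, w, rfl, h⟩⟩ else ⟨(v, none), Or.inl ⟨hv, rfl⟩⟩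

theorem tow_fst {V : Type*} (G : SimpleGraph V) (S' : Set V) (v w : V) (h : G.Adj v w) :
    (tow G S' v w h).1.1 = v := by
  unfold tow; split <;> rfl

theorem tow_adj {V : Type*} (G : SimpleGraph V) (S' : Set V) (v w : V) (h : G.Adj v w) :
    (expand G S').Adj (tow G S' v w h) (tow G S' w v h.symm) := by
  have h1 : tow G S' v w h ≠ tow G S' w v h.symm := by
    intro e
    have := congrArg (fun p => p.1.1) e
    simp only [tow_fst] at this
    exact h.ne this
  refine (SimpleGraph.fromRel_adj _ _ _).2 ⟨h1, ?_⟩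
  unfold tow
  split_ifs <;> simp [h]

theorem good_expand {V : Type*} {G : SimpleGraph V} {S' : Set V} (hG : Good G)
    (hS : Cubic G S') : Good (expand G S') := by
  refine good_blow (fun p => p.1.1) hG ?_ ?_
  · intro v w h
    exact ⟨_, _, tow_fst _ _ _ _ h, tow_fst _ _ _ _ h.symm, tow_adj _ _ _ _ h⟩
  · intro v
    by_cases hv : v ∈ S'
    · obtain ⟨n, hn, hadj⟩ := hS v hv
      have ha : ∀ i, G.Adj v (n i) := fun i => (hadj _).2 ⟨i, rfl⟩
      have htow : ∀ i, tow G S' v (n i) (ha i) = ⟨(v, some (n i)), Or.inr ⟨hv, _, rfl, ha i⟩⟩ := by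
        intro i; simp [tow, hv]
      have hinj : Function.Injective (fun i => tow G S' v (n i) (ha i)) := by
        intro i j h
        simp only [htow, Subtype.mk.injEq, Prod.mk.injEq, Option.some.injEq, true_and] at h
        exact hn h
      refine fib_tri (fun i => tow G S' v (n i) (ha i)) (fun i => tow G S' (n i) v (ha i).symm)
        hinj ?_ ?_ (fun i => tow_adj _ _ _ _ _) ?_ ?_
      · rintro ⟨⟨a, b⟩, hab⟩
        constructor
        · rintro (rfl : a = v)
          rcases hab with hab | ⟨_, w, hw, hw'⟩
          · exact (hab.1 hv).elim
          · obtain ⟨i, rfl⟩ := (hadj w).1 hw'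
            refine ⟨i, ?_⟩
            simp only at hw
            subst hw
            rw [htow]
        · rintro ⟨i, hi⟩
          rw [hi]; exact tow_fst _ _ _ _ _
      · intro i j hij
        refine (SimpleGraph.fromRel_adj _ _ _).2 ⟨hinj.ne hij, ?_⟩
        left; right; right
        rw [htow, htow]
        exact ⟨_, _, rfl, rfl, Or.inl ⟨rfl, hn.ne hij⟩⟩
      · intro i
        simp only [tow_fst]
        exact (ha i).ne.symm
      · intro i j h
        simp only [tow_fst] at h
        exact hn h
    · apply fib_single
      rintro ⟨⟨a, b⟩, hab⟩ ⟨⟨a', b'⟩, hab'⟩ (rfl : a = v) (rfl : a' = a)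
      rcases hab with ⟨_, h⟩ | h
      · rcases hab' with ⟨_, h'⟩ | h'
        · simp only at h h'
          subst h h'; rfl
        · exact (hv h'.1).elim
      · exact (hv h.1).elim

theorem card_expand {V : Type*} [Fintype V] {G : SimpleGraph V} {S' : Set V}
    (hS : Cubic G S') : Fintype.card (ExpandVerts G S') = Fintype.card V + 2 * S'.ncard := by
  classical
  have hS' : ∀ v : S', ∃ n : Fin 3 → V, Function.Injective n ∧ ∀ w, G.Adj v w ↔ ∃ i, w = n i :=
    fun v => hS v v.2
  choose n hn hadj using hS'
  let F : {v // v ∉ S'} ⊕ (S' × Fin 3) → ExpandVerts G S' := fun p => match p with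
    | Sum.inl v => ⟨(v, none), Or.inl ⟨v.2, rfl⟩⟩
    | Sum.inr (v, i) => ⟨(v, some (n v i)), Or.inr ⟨v.2, _, rfl, (hadj v _).2 ⟨i, rfl⟩⟩⟩
  have hF : Function.Bijective F := by
    constructor
    · rintro (⟨v, hv⟩ | ⟨⟨v, hv⟩, i⟩) (⟨w, hw⟩ | ⟨⟨w, hw⟩, j⟩) h
      · simp only [F, Subtype.mk.injEq, Prod.mk.injEq] at h
        simp [h.1]
      · simp [F] at h
      · simp [F] at h
      · simp only [F, Subtype.mk.injEq, Prod.mk.injEq, Option.some.injEq] at h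
        obtain ⟨rfl, h⟩ := h
        rw [hn _ h]
    · rintro ⟨⟨a, b⟩, (⟨h, h'⟩ | ⟨h, w, h', hw⟩)⟩
      · simp only at h'
        subst h'
        exact ⟨Sum.inl ⟨a, h⟩, rfl⟩
      · simp only at h'
        subst h'
        obtain ⟨i, hi⟩ := (hadj ⟨a, h⟩ w).1 hw
        exact ⟨Sum.inr (⟨a, h⟩, i), by simp [F, hi]⟩
  rw [← Fintype.card_of_bijective hF, Fintype.card_sum, Fintype.card_prod, Fintype.card_fin,
    Fintype.card_subtype_compl]
  have h1 : Fintype.card S' = S'.ncard := by rw [← Nat.card_coe_set_eq, Nat.card_eq_fintype_card]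
  have h2 : Fintype.card {x // x ∈ S'} = S'.ncard := h1
  have h3 : Fintype.card {x // x ∈ S'} ≤ Fintype.card V := Fintype.card_subtype_le _
  rw [h2] at *
  omega

/-- Contract the last layer and `u`. -/
def proj (t : ℕ) : (Fin (t + 1 + 1) × Fin 4) ⊕ Bool → (Fin (t + 1) × Fin 4) ⊕ Bool
  | Sum.inl (s, j) => if h : s.val < t + 1 then Sum.inl (⟨s, h⟩, j) else Sum.inr false
  | Sum.inr b => Sum.inr b

theorem adj_path (t : ℕ) (s : Fin (t + 1)) (j j' : Fin 4) (h : (j' : ℕ) = j + 1) :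
    (G't t).Adj (Sum.inl (s, j)) (Sum.inl (s, j')) := by
  refine (SimpleGraph.fromRel_adj _ _ _).2 ⟨?_, Or.inl (Or.inl ⟨s, j, j', h, rfl, rfl⟩)⟩
  rintro ⟨⟩
  omega

theorem adj_one (t : ℕ) (s s' : Fin (t + 1)) (h : (s' : ℕ) = s + 1) :
    (G't t).Adj (Sum.inl (s, 0)) (Sum.inl (s', 0)) := by
  refine (SimpleGraph.fromRel_adj _ _ _).2
    ⟨?_, Or.inl (Or.inr (Or.inl ⟨s, s', h, Or.inl ⟨rfl, rfl⟩⟩))⟩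
  rintro ⟨⟩
  omega

theorem adj_four (t : ℕ) (s s' : Fin (t + 1)) (h : (s' : ℕ) = s + 1) :
    (G't t).Adj (Sum.inl (s, 3)) (Sum.inl (s', 2)) := by
  refine (SimpleGraph.fromRel_adj _ _ _).2
    ⟨by simp, Or.inl (Or.inr (Or.inl ⟨s, s', h, Or.inr ⟨rfl, rfl⟩⟩))⟩

theorem adj_u1 (t : ℕ) : (G't t).Adj (Sum.inl (Fin.last t, 0)) (Sum.inr false) :=
  (SimpleGraph.fromRel_adj _ _ _).2 ⟨by simp, Or.inl (Or.inr (Or.inr (Or.inl ⟨rfl, rfl⟩)))⟩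

theorem adj_u4 (t : ℕ) : (G't t).Adj (Sum.inl (Fin.last t, 3)) (Sum.inr false) :=
  (SimpleGraph.fromRel_adj _ _ _).2
    ⟨by simp, Or.inl (Or.inr (Or.inr (Or.inr (Or.inl ⟨rfl, rfl⟩))))⟩

theorem adj_S (t : ℕ) (p) (h : p ∈ Sset t) : (G't t).Adj p (Sum.inr true) := by
  refine (SimpleGraph.fromRel_adj _ _ _).2
    ⟨?_, Or.inl (Or.inr (Or.inr (Or.inr (Or.inr ⟨h, rfl⟩))))⟩
  rintro rfl
  simp [Sset] at h

theorem mem_S (t : ℕ) (p) : p ∈ Sset t ↔ (p = Sum.inl (0, 0) ∨ p = Sum.inl (0, 2) ∨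
    p = Sum.inr false ∨ ∃ s : Fin (t + 1), p = Sum.inl (s, 1) ∨ p = Sum.inl (s, 3)) := Iff.rfl

/-- Induction along the oriented edges of `G't`. -/
theorem adj_cases {t : ℕ} {p q} (h : (G't t).Adj p q)
    {P : ((Fin (t + 1) × Fin 4) ⊕ Bool) → ((Fin (t + 1) × Fin 4) ⊕ Bool) → Prop}
    (symm : ∀ p q, P p q → P q p)
    (path : ∀ (s : Fin (t + 1)) (j j' : Fin 4), (j' : ℕ) = j + 1 →
      P (Sum.inl (s, j)) (Sum.inl (s, j')))
    (one : ∀ s s' : Fin (t + 1), (s' : ℕ) = s + 1 → P (Sum.inl (s, 0)) (Sum.inl (s', 0)))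
    (four : ∀ s s' : Fin (t + 1), (s' : ℕ) = s + 1 → P (Sum.inl (s, 3)) (Sum.inl (s', 2)))
    (u1 : P (Sum.inl (Fin.last t, 0)) (Sum.inr false))
    (u4 : P (Sum.inl (Fin.last t, 3)) (Sum.inr false))
    (hS : ∀ p ∈ Sset t, P p (Sum.inr true)) : P p q := by
  have key : ∀ p q, ((∃ (s : Fin (t + 1)) (j j' : Fin 4), (j' : ℕ) = (j : ℕ) + 1 ∧
        p = Sum.inl (s, j) ∧ q = Sum.inl (s, j')) ∨
    (∃ s s' : Fin (t + 1), (s' : ℕ) = (s : ℕ) + 1 ∧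
        ((p = Sum.inl (s, 0) ∧ q = Sum.inl (s', 0)) ∨
         (p = Sum.inl (s, 3) ∧ q = Sum.inl (s', 2)))) ∨
    (p = Sum.inl (Fin.last t, 0) ∧ q = Sum.inr false) ∨
    (p = Sum.inl (Fin.last t, 3) ∧ q = Sum.inr false) ∨
    (p ∈ Sset t ∧ q = Sum.inr true)) → P p q := by
    rintro p q (⟨s, j, j', h, rfl, rfl⟩ | ⟨s, s', h, (⟨rfl, rfl⟩ | ⟨rfl, rfl⟩)⟩ | ⟨rfl, rfl⟩ |
      ⟨rfl, rfl⟩ | ⟨h, rfl⟩)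
    · exact path _ _ _ h
    · exact one _ _ h
    · exact four _ _ h
    · exact u1
    · exact u4
    · exact hS _ h
  rcases ((SimpleGraph.fromRel_adj _ _ _).1 h).2 with h | h
  · exact key _ _ h
  · exact symm _ _ (key _ _ h)

theorem good_step (t : ℕ) (h : Good (G't t)) : Good (G't (t + 1)) := by
  have pc : ∀ (s : Fin (t + 1)) j, proj t (Sum.inl (s.castSucc, j)) = Sum.inl (s, j) := by
    intro s j; simp [proj, s.2]
  have pl : ∀ j, proj t (Sum.inl (Fin.last (t + 1), j)) = Sum.inr false := by
    intro j; simp [proj]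
  refine good_blow (proj t) h ?_ ?_
  · intro v w hvw
    refine adj_cases hvw (P := fun v w => ∃ p q, proj t p = v ∧ proj t q = w ∧
      (G't (t + 1)).Adj p q) ?_ ?_ ?_ ?_ ?_ ?_ ?_
    · rintro p q ⟨a, b, h1, h2, h3⟩
      exact ⟨b, a, h2, h1, h3.symm⟩
    · intro s j j' hj
      exact ⟨_, _, pc _ _, pc _ _, adj_path _ _ _ _ hj⟩
    · intro s s' hs
      exact ⟨_, _, pc _ _, pc _ _, adj_one _ _ _ (by simpa using hs)⟩
    · intro s s' hs
      exact ⟨_, _, pc _ _, pc _ _, adj_four _ _ _ (by simpa using hs)⟩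
    · exact ⟨_, _, pc _ _, pl _, adj_one _ _ _ (by simp)⟩
    · exact ⟨_, _, pc _ _, pl _, adj_four _ _ _ (by simp)⟩
    · rintro p (rfl | rfl | rfl | ⟨s, (rfl | rfl)⟩)
      · exact ⟨_, Sum.inr true, pc _ _, rfl, adj_S _ _ (Or.inl (by simp))⟩
      · exact ⟨_, Sum.inr true, pc _ _, rfl, adj_S _ _ (Or.inr (Or.inl (by simp)))⟩
      · exact ⟨Sum.inr false, Sum.inr true, rfl, rfl, adj_S _ _ (Or.inr (Or.inr (Or.inl rfl)))⟩
      · exact ⟨_, Sum.inr true, pc _ _, rfl,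
          adj_S _ _ (Or.inr (Or.inr (Or.inr ⟨_, Or.inl rfl⟩)))⟩
      · exact ⟨_, Sum.inr true, pc _ _, rfl,
          adj_S _ _ (Or.inr (Or.inr (Or.inr ⟨_, Or.inr rfl⟩)))⟩
  · intro v
    by_cases hv : v = Sum.inr false
    · subst hv
      refine fib_pent
        ![Sum.inr false, Sum.inl (Fin.last (t + 1), 0), Sum.inl (Fin.last (t + 1), 1),
          Sum.inl (Fin.last (t + 1), 2), Sum.inl (Fin.last (t + 1), 3)]
        ![Sum.inr true, Sum.inl ((Fin.last t).castSucc, 0), Sum.inr true,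
          Sum.inl ((Fin.last t).castSucc, 3), Sum.inr true] ?_ ?_ ?_ ?_ ?_ ?_
      · intro i j
        fin_cases i <;> fin_cases j <;> simp
      · rintro (⟨s, j⟩ | b)
        · induction s using Fin.lastCases with
          | last =>
            simp only [pl, true_iff]
            fin_cases j
            · exact ⟨1, rfl⟩
            · exact ⟨2, rfl⟩
            · exact ⟨3, rfl⟩
            · exact ⟨4, rfl⟩
          | cast s =>
            simp only [pc, reduceCtorEq, false_iff, not_exists]
            intro i
            have := Fin.castSucc_ne_last s
            fin_cases i <;> simp [this]
        · cases b
          · simp only [proj, true_iff]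
            exact ⟨0, rfl⟩
          · simp only [proj, Sum.inr.injEq, reduceCtorEq, false_iff, not_exists]
            intro i
            fin_cases i <;> simp
      · intro i
        fin_cases i
        · exact (adj_u1 (t + 1)).symm
        · exact adj_path _ _ 0 1 rfl
        · exact adj_path _ _ 1 2 rfl
        · exact adj_path _ _ 2 3 rfl
        · exact adj_u4 _
      · intro i
        fin_cases i
        · exact adj_S _ _ (Or.inr (Or.inr (Or.inl rfl)))
        · exact (adj_one _ _ _ (by simp)).symm
        · exact adj_S _ _ (Or.inr (Or.inr (Or.inr ⟨_, Or.inl rfl⟩)))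
        · exact (adj_four _ _ _ (by simp)).symm
        · exact adj_S _ _ (Or.inr (Or.inr (Or.inr ⟨_, Or.inr rfl⟩)))
      · intro i
        fin_cases i
        · simp [proj]
        · show proj t (Sum.inl ((Fin.last t).castSucc, 0)) ≠ _
          simp [pc]
        · simp [proj]
        · show proj t (Sum.inl ((Fin.last t).castSucc, 3)) ≠ _
          simp [pc]
        · simp [proj]
      · intro i b
        by_cases hb : b = Sum.inr true
        · subst hb
          by_cases hi : i = 1
          · refine ⟨3, by simp [hi], ?_⟩
            show proj t (Sum.inl ((Fin.last t).castSucc, 3)) ≠ _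
            simp [pc]
          · refine ⟨1, Ne.symm hi, ?_⟩
            show proj t (Sum.inl ((Fin.last t).castSucc, 0)) ≠ _
            simp [pc]
        · by_cases hi : i = 0
          · exact ⟨2, by simp [hi], Ne.symm hb⟩
          · exact ⟨0, Ne.symm hi, Ne.symm hb⟩
    · apply fib_single
      rintro (⟨s, j⟩ | b) (⟨s', j'⟩ | b') h1 h2
      · induction s using Fin.lastCases with
        | last => rw [pl] at h1; exact (hv h1.symm).elim
        | cast s =>
          induction s' using Fin.lastCases with
          | last => rw [pl] at h2; exact (hv h2.symm).elim
          | cast s' =>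
            rw [pc] at h1 h2
            rw [← h2] at h1
            simp only [Sum.inl.injEq, Prod.mk.injEq] at h1
            simp [h1]
      · induction s using Fin.lastCases with
        | last => rw [pl] at h1; exact (hv h1.symm).elim
        | cast s => rw [pc] at h1; rw [← h2] at h1; simp [proj] at h1
      · induction s' using Fin.lastCases with
        | last => rw [pl] at h2; exact (hv h2.symm).elim
        | cast s => rw [pc] at h2; rw [← h1] at h2; simp [proj] at h2
      · have h3 := h1.trans h2.symm
        simpa [proj] using h3

/-- Adjacency in the 5-wheel with rim `0,1,2,3,4` and hub `5`. -/
def wadj (a b : Fin 6) : Bool :=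
  a != b && (a == 5 || b == 5 || (a : ℕ) + 1 == b || (b : ℕ) + 1 == a ||
    ((a : ℕ) == 0 && (b : ℕ) == 4) || ((b : ℕ) == 0 && (a : ℕ) == 4))

/-- The 5-wheel. -/
def W5 : SimpleGraph (Fin 6) where
  Adj a b := wadj a b = true
  symm := ⟨by decide⟩
  loopless := ⟨by decide⟩

set_option synthInstance.maxHeartbeats 400000 in
set_option synthInstance.maxSize 4096 in
theorem good_W5 : Good W5 := by
  constructor
  · have : ∀ x y : Fin 6, x ≠ y → ∃ a, a ≠ x ∧ a ≠ y ∧ ∃ b, wadj a b = true ∧ b ≠ x ∧ b ≠ y ∧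
        ∃ c, c ≠ x ∧ c ≠ y ∧ c ≠ a ∧ c ≠ b ∧ ∃ d, wadj c d = true ∧ d ≠ x ∧ d ≠ y ∧ d ≠ a ∧ d ≠ b ∧
        ∀ e, e = x ∨ e = y ∨ e = a ∨ e = b ∨ e = c ∨ e = d := by
      decide +kernel
    intro x y hxy
    obtain ⟨a, ha1, ha2, b, hab, hb1, hb2, c, hc1, hc2, hc3, hc4, d, hcd, hd1, hd2, hd3, hd4, he⟩ :=
      this x y hxy
    have h1 : W5.Adj a b := hab
    have h2 : W5.Adj c d := hcd
    refine ((PMon.pair h1).union (PMon.pair h2) ?_).congr ?_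
    · rw [Set.disjoint_left]
      rintro e (rfl | rfl) (rfl | rfl) <;> contradiction
    · ext e
      have := he e
      simp only [Set.mem_compl_iff, Set.mem_insert_iff, Set.mem_singleton_iff, Set.mem_union]
      grind
  · have : ∀ x y p : Fin 6, p ≠ x → p ≠ y → ∀ q, q ≠ x → q ≠ y → p = q ∨ wadj p q = true ∨
        ∃ r, wadj p r = true ∧ r ≠ x ∧ r ≠ y ∧ (wadj r q = true ∨
        ∃ s, wadj r s = true ∧ s ≠ x ∧ s ≠ y ∧ wadj s q = true) := by
      decide +kernel
    intro x y p hp q hq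
    simp only [Set.mem_compl_iff, Set.mem_insert_iff, Set.mem_singleton_iff, not_or] at hp hq
    have mem : ∀ z, z ≠ x → z ≠ y → z ∈ ({x, y}ᶜ : Set (Fin 6)) := by
      intro z h1 h2; simp [h1, h2]
    have sg : ∀ a b, wadj a b = true → a ≠ x → a ≠ y → b ≠ x → b ≠ y → Reach W5 {x, y}ᶜ a b :=
      fun a b h h1 h2 h3 h4 => Reach.single h (mem _ h1 h2) (mem _ h3 h4)
    rcases this x y p hp.1 hp.2 q hq.1 hq.2 with rfl | h | ⟨r, h1, h2, h3, (h | ⟨s, h4, h5, h6, h7⟩)⟩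
    · exact Reach.rfl'
    · exact sg _ _ h hp.1 hp.2 hq.1 hq.2
    · exact (sg _ _ h1 hp.1 hp.2 h2 h3).trans (sg _ _ h h2 h3 hq.1 hq.2)
    · exact ((sg _ _ h1 hp.1 hp.2 h2 h3).trans (sg _ _ h4 h2 h3 h5 h6)).trans
        (sg _ _ h7 h5 h6 hq.1 hq.2)

/-- Labelling of `G't 0` by the vertices of the wheel. -/
def lab : (Fin (0 + 1) × Fin 4) ⊕ Bool → Fin 6
  | Sum.inl (_, j) => ⟨j, by omega⟩
  | Sum.inr false => 4
  | Sum.inr true => 5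

theorem good_zero : Good (G't 0) := by
  have hS : ∀ p, p ≠ Sum.inr true → p ∈ Sset 0 := by
    rintro (⟨s, j⟩ | b) h
    · obtain rfl : s = 0 := Fin.ext (by omega)
      rw [mem_S]
      fin_cases j <;> simp
    · cases b
      · simp [mem_S]
      · exact (h rfl).elim
  let c : Fin 6 → (Fin (0 + 1) × Fin 4) ⊕ Bool := ![Sum.inl (0, 0), Sum.inl (0, 1), Sum.inl (0, 2),
    Sum.inl (0, 3), Sum.inr false, Sum.inr true]
  have hc : ∀ v, lab (c v) = v := by
    intro v; fin_cases v <;> rfl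
  refine good_blow lab good_W5 ?_ ?_
  · intro v w h
    refine ⟨c v, c w, hc v, hc w, ?_⟩
    have e01 := adj_path 0 0 0 1 rfl
    have e12 := adj_path 0 0 1 2 rfl
    have e23 := adj_path 0 0 2 3 rfl
    have e3 : (G't 0).Adj (Sum.inl (0, 3)) (Sum.inr false) := adj_u4 0
    have e0 : (G't 0).Adj (Sum.inl (0, 0)) (Sum.inr false) := adj_u1 0
    have h0 := adj_S 0 (Sum.inl (0, 0)) (hS _ (by simp))
    have h1 := adj_S 0 (Sum.inl (0, 1)) (hS _ (by simp))
    have h2 := adj_S 0 (Sum.inl (0, 2)) (hS _ (by simp))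
    have h3 := adj_S 0 (Sum.inl (0, 3)) (hS _ (by simp))
    have h4 := adj_S 0 (Sum.inr false) (hS _ (by simp))
    change wadj v w = true at h
    fin_cases v <;> fin_cases w <;>
      first
      | exact absurd h (by decide)
      | assumption
      | (apply SimpleGraph.Adj.symm; assumption)
  · intro v
    apply fib_single
    rintro (⟨s, j⟩ | b) (⟨s', j'⟩ | b') h1 h2
    · obtain rfl : s = s' := Fin.ext (by omega)
      have := h1.trans h2.symm
      simp only [lab, Fin.mk.injEq] at this
      rw [Fin.ext this]
    all_goals
      have := h1.trans h2.symm
      revert this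
    · cases b' <;> fin_cases j <;> simp [lab]
    · cases b <;> fin_cases j' <;> simp [lab]
    · cases b <;> cases b' <;> simp [lab]

theorem good_G't (t : ℕ) : Good (G't t) := by
  induction t with
  | zero => exact good_zero
  | succ t ih => exact good_step t ih

theorem cubic_aux {V : Type*} {G : SimpleGraph V} {v a b c : V} (hab : a ≠ b) (hac : a ≠ c)
    (hbc : b ≠ c) (h : ∀ w, G.Adj v w ↔ w = a ∨ w = b ∨ w = c) :
    ∃ n : Fin 3 → V, Function.Injective n ∧ ∀ w, G.Adj v w ↔ ∃ i, w = n i := by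
  refine ⟨![a, b, c], ?_, ?_⟩
  · intro i j
    fin_cases i <;> fin_cases j <;> simp [hab, hac, hbc, hab.symm, hac.symm, hbc.symm]
  · intro w
    rw [h]
    simp [Fin.exists_fin_succ]

theorem nbr_aux {t : ℕ} {v a b c : (Fin (t + 1) × Fin 4) ⊕ Bool}
    (path : ∀ (s : Fin (t + 1)) (j j' : Fin 4), (j' : ℕ) = j + 1 →
      (Sum.inl (s, j) = v → Sum.inl (s, j') = a ∨ Sum.inl (s, j') = b ∨ Sum.inl (s, j') = c) ∧
      (Sum.inl (s, j') = v → Sum.inl (s, j) = a ∨ Sum.inl (s, j) = b ∨ Sum.inl (s, j) = c))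
    (one : ∀ s s' : Fin (t + 1), (s' : ℕ) = s + 1 →
      (Sum.inl (s, 0) = v → Sum.inl (s', 0) = a ∨ Sum.inl (s', 0) = b ∨ Sum.inl (s', 0) = c) ∧
      (Sum.inl (s', 0) = v → Sum.inl (s, 0) = a ∨ Sum.inl (s, 0) = b ∨ Sum.inl (s, 0) = c))
    (four : ∀ s s' : Fin (t + 1), (s' : ℕ) = s + 1 →
      (Sum.inl (s, 3) = v → Sum.inl (s', 2) = a ∨ Sum.inl (s', 2) = b ∨ Sum.inl (s', 2) = c) ∧
      (Sum.inl (s', 2) = v → Sum.inl (s, 3) = a ∨ Sum.inl (s, 3) = b ∨ Sum.inl (s, 3) = c))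
    (u1 : (Sum.inl (Fin.last t, 0) = v → Sum.inr false = a ∨ Sum.inr false = b ∨ Sum.inr false = c) ∧
      (Sum.inr false = v → Sum.inl (Fin.last t, 0) = a ∨ Sum.inl (Fin.last t, 0) = b ∨
        Sum.inl (Fin.last t, 0) = c))
    (u4 : (Sum.inl (Fin.last t, 3) = v → Sum.inr false = a ∨ Sum.inr false = b ∨ Sum.inr false = c) ∧
      (Sum.inr false = v → Sum.inl (Fin.last t, 3) = a ∨ Sum.inl (Fin.last t, 3) = b ∨
        Sum.inl (Fin.last t, 3) = c))
    (hc : c = Sum.inr true) (hv : v ∈ Sset t) (ha : (G't t).Adj v a) (hb : (G't t).Adj v b)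
    (w : (Fin (t + 1) × Fin 4) ⊕ Bool) :
    (G't t).Adj v w ↔ w = a ∨ w = b ∨ w = c := by
  constructor
  · intro h
    refine (adj_cases h (P := fun p q => (p = v → q = a ∨ q = b ∨ q = c) ∧
      (q = v → p = a ∨ p = b ∨ p = c)) (fun p q h => ⟨h.2, h.1⟩) path one four u1 u4 ?_).1 rfl
    intro p hp
    refine ⟨fun _ => Or.inr (Or.inr hc.symm), ?_⟩
    rintro rfl
    simp [mem_S] at hv
  · rintro (rfl | rfl | rfl)
    · exact ha
    · exact hb
    · rw [hc]; exact adj_S _ _ hv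

set_option linter.unusedSimpArgs false in
theorem cubic_S (t : ℕ) (ht : 1 ≤ t) : Cubic (G't t) (Sset t) := by
  intro v hv
  have hv' := hv
  have v0 : ((0 : Fin 4) : ℕ) = 0 := rfl
  have v1 : ((1 : Fin 4) : ℕ) = 1 := rfl
  have v2 : ((2 : Fin 4) : ℕ) = 2 := rfl
  have v3 : ((3 : Fin 4) : ℕ) = 3 := rfl
  have w0 : ((0 : Fin (t + 1)) : ℕ) = 0 := rfl
  have wl : ((Fin.last t : Fin (t + 1)) : ℕ) = t := rfl
  rcases hv with rfl | rfl | rfl | ⟨s, (rfl | rfl)⟩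
  · refine cubic_aux (a := Sum.inl (0, 1)) (b := Sum.inl (⟨1, by omega⟩, 0)) (c := Sum.inr true)
      (by simp) (by simp) (by simp)
      (nbr_aux ?_ ?_ ?_ ?_ ?_ rfl hv' (adj_path _ _ 0 1 rfl) (adj_one _ _ _ (by simp)))
    all_goals
      intros
      refine ⟨fun h => ?_, fun h => ?_⟩ <;>
      simp only [Sum.inl.injEq, Prod.mk.injEq, reduceCtorEq, Fin.ext_iff, v0, v1, v2, v3, w0, wl,
        false_or, or_false, true_or, or_true, and_true, and_false] at h ⊢ <;> omega
  · refine cubic_aux (a := Sum.inl (0, 1)) (b := Sum.inl (0, 3)) (c := Sum.inr true)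
      (by simp) (by simp) (by simp)
      (nbr_aux ?_ ?_ ?_ ?_ ?_ rfl hv' (adj_path _ _ 1 2 rfl).symm (adj_path _ _ 2 3 rfl))
    all_goals
      intros
      refine ⟨fun h => ?_, fun h => ?_⟩ <;>
      simp only [Sum.inl.injEq, Prod.mk.injEq, reduceCtorEq, Fin.ext_iff, v0, v1, v2, v3, w0, wl,
        false_or, or_false, true_or, or_true, and_true, and_false] at h ⊢ <;> omega
  · refine cubic_aux (a := Sum.inl (Fin.last t, 0)) (b := Sum.inl (Fin.last t, 3))
      (c := Sum.inr true) (by simp) (by simp) (by simp)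
      (nbr_aux ?_ ?_ ?_ ?_ ?_ rfl hv' (adj_u1 t).symm (adj_u4 t).symm)
    all_goals
      intros
      refine ⟨fun h => ?_, fun h => ?_⟩ <;>
      simp only [Sum.inl.injEq, Prod.mk.injEq, reduceCtorEq, Fin.ext_iff, v0, v1, v2, v3, w0, wl,
        false_or, or_false, true_or, or_true, and_true, and_false] at h ⊢ <;> omega
  · refine cubic_aux (a := Sum.inl (s, 0)) (b := Sum.inl (s, 2))
      (c := Sum.inr true) (by simp) (by simp) (by simp)
      (nbr_aux ?_ ?_ ?_ ?_ ?_ rfl hv' (adj_path _ _ 0 1 rfl).symm (adj_path _ _ 1 2 rfl))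
    all_goals
      intros
      refine ⟨fun h => ?_, fun h => ?_⟩ <;>
      simp only [Sum.inl.injEq, Prod.mk.injEq, reduceCtorEq, Fin.ext_iff, v0, v1, v2, v3, w0, wl,
        false_or, or_false, true_or, or_true, and_true, and_false] at h ⊢ <;> omega
  · by_cases hs : s = Fin.last t
    · subst hs
      refine cubic_aux (a := Sum.inl (Fin.last t, 2)) (b := Sum.inr false)
        (c := Sum.inr true) (by simp) (by simp) (by simp)
        (nbr_aux ?_ ?_ ?_ ?_ ?_ rfl hv' (adj_path _ _ 2 3 rfl).symm (adj_u4 t))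
      all_goals
        intros
        refine ⟨fun h => ?_, fun h => ?_⟩ <;>
        simp only [Sum.inl.injEq, Prod.mk.injEq, reduceCtorEq, Fin.ext_iff, v0, v1, v2, v3, w0, wl,
          false_or, or_false, true_or, or_true, and_true, and_false] at h ⊢ <;> omega
    · have hs' : (s : ℕ) ≠ t := fun h => hs (Fin.ext h)
      refine cubic_aux (a := Sum.inl (s, 2)) (b := Sum.inl (⟨s + 1, by omega⟩, 2))
        (c := Sum.inr true) (by simp [Fin.ext_iff]) (by simp) (by simp)
        (nbr_aux ?_ ?_ ?_ ?_ ?_ rfl hv' (adj_path _ _ 2 3 rfl).symm (adj_four _ _ _ rfl))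
      all_goals
        intros
        refine ⟨fun h => ?_, fun h => ?_⟩ <;>
        simp only [Sum.inl.injEq, Prod.mk.injEq, reduceCtorEq, Fin.ext_iff, v0, v1, v2, v3, w0, wl,
          false_or, or_false, true_or, or_true, and_true, and_false] at h ⊢ <;> omega

theorem ncard_S (t : ℕ) : (Sset t).ncard = 2 * (t + 1) + 3 := by
  classical
  let F : (Fin (t + 1) × Bool) ⊕ Fin 3 → (Fin (t + 1) × Fin 4) ⊕ Bool := fun p => match p with
    | Sum.inl (s, b) => Sum.inl (s, if b then 1 else 3)
    | Sum.inr i => ![Sum.inl (0, 0), Sum.inl (0, 2), Sum.inr false] i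
  have hF : Function.Injective F := by
    rintro (⟨s, b⟩ | i) (⟨s', b'⟩ | j)
    · cases b <;> cases b' <;> simp [F]
    · cases b <;> fin_cases j <;> simp [F]
    · cases b' <;> fin_cases i <;> simp [F]
    · fin_cases i <;> fin_cases j <;> simp [F]
  have hr : Sset t = Set.range F := by
    ext p
    rw [mem_S]
    constructor
    · rintro (rfl | rfl | rfl | ⟨s, (rfl | rfl)⟩)
      · exact ⟨Sum.inr 0, rfl⟩
      · exact ⟨Sum.inr 1, rfl⟩
      · exact ⟨Sum.inr 2, rfl⟩
      · exact ⟨Sum.inl (s, true), rfl⟩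
      · exact ⟨Sum.inl (s, false), rfl⟩
    · rintro ⟨(⟨s, b⟩ | i), rfl⟩
      · cases b <;> simp [F]
      · fin_cases i <;> simp [F]
  rw [hr, ← Set.image_univ, Set.ncard_image_of_injective _ hF, Set.ncard_univ]
  simp
  ring

theorem Ssub_sub (t k : ℕ) : Ssub t k ⊆ Sset t := by
  unfold Ssub
  split
  · exact Set.sdiff_subset
  · exact Set.sdiff_subset
  · exact Set.sdiff_subset
  · exact subset_rfl

theorem ncard_Ssub (t k : ℕ) (h1 : 1 ≤ k) (h4 : k ≤ 4) :
    (Ssub t k).ncard + 4 = 2 * (t + 1) + 3 + k := by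
  have hS := ncard_S t
  have m1 : Sum.inl (Fin.last t, 1) ∈ Sset t := by simp [mem_S]
  have m3 : Sum.inl (Fin.last t, 3) ∈ Sset t := by simp [mem_S]
  have mu : Sum.inr false ∈ Sset t := by simp [mem_S]
  interval_cases k
  · have hs : ({Sum.inl (Fin.last t, 1), Sum.inl (Fin.last t, 3), Sum.inr false} :
        Set ((Fin (t + 1) × Fin 4) ⊕ Bool)) ⊆ Sset t := by
      rintro _ (rfl | rfl | rfl) <;> assumption
    have h := Set.ncard_sdiff_add_ncard_of_subset hs
    have h3 : ({Sum.inl (Fin.last t, 1), Sum.inl (Fin.last t, 3), Sum.inr false} :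
        Set ((Fin (t + 1) × Fin 4) ⊕ Bool)).ncard = 3 :=
      Set.ncard_eq_three.2 ⟨_, _, _, by simp, by simp, by simp, rfl⟩
    simp only [Ssub]
    omega
  · have hs : ({Sum.inl (Fin.last t, 3), Sum.inr false} :
        Set ((Fin (t + 1) × Fin 4) ⊕ Bool)) ⊆ Sset t := by
      rintro _ (rfl | rfl) <;> assumption
    have h := Set.ncard_sdiff_add_ncard_of_subset hs
    have h3 : ({Sum.inl (Fin.last t, 3), Sum.inr false} :
        Set ((Fin (t + 1) × Fin 4) ⊕ Bool)).ncard = 2 :=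
      Set.ncard_eq_two.2 ⟨_, _, by simp, rfl⟩
    simp only [Ssub]
    omega
  · have hs : ({Sum.inr false} : Set ((Fin (t + 1) × Fin 4) ⊕ Bool)) ⊆ Sset t := by
      rintro _ rfl; assumption
    have h := Set.ncard_sdiff_add_ncard_of_subset hs
    have h3 := Set.ncard_singleton (Sum.inr false : (Fin (t + 1) × Fin 4) ⊕ Bool)
    simp only [Ssub]
    omega
  · simp only [Ssub]
    omega

end Brick

/-- For every even integer `n ≥ 18`, writing `n = i + 8(t+1)` with
`t ≥ 1` and `0 < i ≤ 8`, the graph `G''_n = G'_t⟨S_{i/2}⟩` is a brick on `n` vertices. -/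
theorem stmt6 (n t i : ℕ) (hne : Even n) (hn : 18 ≤ n) (ht : 1 ≤ t)
    (hi0 : 0 < i) (hi8 : i ≤ 8) (heq : n = i + 8 * (t + 1)) :
    IsBrick (expand (G't t) (Ssub t (i / 2))) ∧
      Fintype.card (ExpandVerts (G't t) (Ssub t (i / 2))) = n := by
  have hi : i % 2 = 0 := by
    rw [heq, Nat.even_add] at hne
    have : Even (8 * (t + 1)) := ⟨4 * (t + 1), by ring⟩
    exact Nat.even_iff.1 (hne.2 this)
  have hcub : Brick.Cubic (G't t) (Ssub t (i / 2)) :=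
    fun v hv => Brick.cubic_S t ht v (Brick.Ssub_sub t _ hv)
  have hcard : Fintype.card (ExpandVerts (G't t) (Ssub t (i / 2))) = n := by
    rw [Brick.card_expand hcub]
    have h := Brick.ncard_Ssub t (i / 2) (by omega) (by omega)
    simp only [Fintype.card_sum, Fintype.card_prod, Fintype.card_fin, Fintype.card_bool]
    omega
  exact ⟨Brick.isBrick_of_good (Brick.good_expand (Brick.good_G't t) hcub) (by omega), hcard⟩
end
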